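/- arXiv:math/0401235 — 5 statements merged into one kernel-verified Lean document; each statement's English description precedes it below -/
import Mathlib

section
/- Let n ≥ 1, c ≥ 0 and 0 ≤ p ≤ n be integers, and assume it is not the case that c = 0 and p = 0. Then the sum Σ_Π q^{n(Π)} over all strict plane partitions Π with parts in {1,…,n}, at most c columns and exactly p rows of odd length equals, in ℚ(q): if c is even, q^{p(p+1)/2}·binq(n,p)·(1/[c+p;q]_{n+1})·∏_{i=0}^{n} [c+2i;q]_{n−i+1}/[2+2i;q]_{n−i}; if c is odd, q^{p(p+1)/2}·binq(n,p)·∏_{i=1}^{n} [c+2i−1;q]_{n−i+1}/[2i;q]_{n−i+1}. -/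
open Finset

noncomputable def q : RatFunc ℚ := RatFunc.X

noncomputable def qb (a : ℤ) : RatFunc ℚ := (1 - q ^ a) / (1 - q)

noncomputable def qfac (a : ℤ) (n : ℕ) : RatFunc ℚ := ∏ i ∈ Finset.range n, qb (a + i)

noncomputable def binq (n k : ℤ) : RatFunc ℚ :=
  if 0 ≤ k ∧ k ≤ n then qfac (n - k + 1) k.toNat / qfac 1 k.toNat else 0

/-- A strict plane partition: entries `part i j` (row `i`, column `j`, both 0-indexed),
zero outside the shape; rows weakly decrease and columns strictly decrease on the shape. -/
structure SPP where
  part : ℕ → ℕ → ℕ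
  supp_finite : {ij : ℕ × ℕ | part ij.1 ij.2 ≠ 0}.Finite
  row_decr : ∀ i j₁ j₂, j₁ ≤ j₂ → part i j₂ ≤ part i j₁
  col_strict : ∀ i j, part (i + 1) j ≠ 0 → part (i + 1) j < part i j

/-- The norm of a strict plane partition: the sum of its parts. -/
noncomputable def sppNorm (P : SPP) : ℕ := ∑ᶠ ij : ℕ × ℕ, P.part ij.1 ij.2

/-- The length of the `i`-th row (0-indexed), i.e. the part `λ_{i+1}` of the shape. -/
noncomputable def rowLen (P : SPP) (i : ℕ) : ℕ := {j | P.part i j ≠ 0}.ncard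

/-- The number of rows of odd length. -/
noncomputable def oddRows (P : SPP) : ℕ := {i | Odd (rowLen P i)}.ncard

/-- The number of parts equal to `n`. -/
noncomputable def eqCount (P : SPP) (n : ℕ) : ℕ := {ij : ℕ × ℕ | P.part ij.1 ij.2 = n}.ncard

/-! ### Elementary symmetric sums and alternants -/

section Alternants

variable {K : Type*} [CommRing K]

/-- The elementary symmetric polynomial of degree `p` evaluated at `x`. -/
def elemSymm {ι : Type*} [Fintype ι] (p : ℕ) (x : ι → K) : K :=
  ∑ S ∈ powersetCard p univ, ∏ i ∈ S, x i

lemma prod_sub_mul_eq_sum_elemSymm {n : ℕ} (x : Fin n → K) (a b : K) :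
    ∏ j, (a - b * x j) =
      ∑ r ∈ range (n + 1), (-1) ^ r * elemSymm r x * (a ^ (n - r) * b ^ r) := by
  have h : ∀ j, a - b * x j = -b * x j + a := fun j => by ring
  simp_rw [h]
  rw [Finset.prod_add, Finset.sum_powerset]
  simp only [card_univ, Fintype.card_fin]
  refine sum_congr rfl fun r _ => ?_
  rw [elemSymm, mul_sum, sum_mul]
  refine sum_congr rfl fun S hS => ?_
  rw [mem_powersetCard] at hS
  rw [prod_mul_distrib, prod_const, prod_const, card_sdiff_of_subset hS.1, hS.2, neg_pow]
  simp only [card_univ, Fintype.card_fin]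
  ring

lemma elemSymm_eq_coeff {n : ℕ} (p : ℕ) (x : Fin n → K) :
    elemSymm p x = (∏ i, (1 + Polynomial.C (x i) * Polynomial.X)).coeff p := by
  rw [Finset.prod_one_add, Polynomial.finsetSum_coeff, elemSymm, powersetCard_eq_filter,
    sum_filter]
  refine sum_congr rfl fun S _ => ?_
  rw [prod_mul_distrib, prod_const, ← map_prod, Polynomial.coeff_C_mul_X_pow]
  simp only [eq_comm]

lemma elemSymm_comp_perm {n : ℕ} (p : ℕ) (x : Fin n → K) (σ : Equiv.Perm (Fin n)) :
    elemSymm p (fun i => x (σ i)) = elemSymm p x := by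
  rw [elemSymm_eq_coeff, elemSymm_eq_coeff]
  rw [Equiv.prod_comp σ fun i => 1 + Polynomial.C (x i) * Polynomial.X]

/-- The alternant whose exponents are the parts `β 0, β 1 + 1, β 2 + 2, …`. -/
def alternant {n : ℕ} (x : Fin n → K) (β : Fin n → ℕ) : K :=
  (Matrix.of fun j i => x i ^ (β j + j)).det

lemma alternant_eq_sum_perm {n : ℕ} (x : Fin n → K) (β : Fin n → ℕ) :
    alternant x β = ∑ σ : Equiv.Perm (Fin n), Equiv.Perm.sign σ • ∏ i, x (σ i) ^ (β i + i) := by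
  rw [alternant, ← Matrix.det_transpose, Matrix.det_apply]
  rfl

/-- Pieri's rule for alternants. -/
lemma elemSymm_mul_alternant {n : ℕ} (p : ℕ) (x : Fin n → K) (β : Fin n → ℕ) :
    elemSymm p x * alternant x β =
      ∑ S ∈ powersetCard p univ, alternant x fun j => β j + if j ∈ S then 1 else 0 := by
  simp_rw [alternant_eq_sum_perm]
  rw [sum_comm, mul_sum]
  refine sum_congr rfl fun σ _ => ?_
  rw [← elemSymm_comp_perm p x σ, elemSymm, ← smul_sum, mul_smul_comm, sum_mul]
  congr 1
  refine sum_congr rfl fun S _ => ?_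
  have h : ∀ i : Fin n, x (σ i) ^ (β i + (if i ∈ S then 1 else 0) + i) =
      (if i ∈ S then x (σ i) else 1) * x (σ i) ^ (β i + i) := by
    intro i
    split_ifs <;> ring
  simp_rw [h, prod_mul_distrib]
  rw [prod_ite_mem, univ_inter]

lemma alternant_zero {n : ℕ} (x : Fin n → K) :
    alternant x 0 = ∏ i, ∏ j ∈ Ioi i, (x j - x i) := by
  rw [← Matrix.det_vandermonde, ← Matrix.det_transpose, alternant]
  congr 1
  ext i j
  simp [Matrix.vandermonde]

lemma alternant_add_one {n : ℕ} (x : Fin n → K) (β : Fin n → ℕ) :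
    alternant x (fun j => β j + 1) = (∏ i, x i) * alternant x β := by
  rw [alternant, alternant, ← Matrix.det_mul_row]
  congr 1
  ext i j
  simp only [Matrix.of_apply]
  ring

lemma alternant_cons_zero {n : ℕ} (x : Fin (n + 1) → K) (β : Fin n → ℕ) :
    alternant x (Fin.cons 0 β) = ∑ i : Fin (n + 1), (-1) ^ (i : ℕ) *
      ((∏ j, x (i.succAbove j)) * alternant (fun j => x (i.succAbove j)) β) := by
  rw [alternant, Matrix.det_succ_row_zero]
  refine sum_congr rfl fun i _ => ?_
  rw [alternant, ← Matrix.det_mul_row]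
  simp only [Matrix.of_apply, Fin.cons_zero, Fin.val_zero, pow_zero, add_zero, mul_one]
  congr 2
  ext j l
  simp only [Matrix.of_apply, Matrix.submatrix_apply, Fin.cons_succ, Fin.val_succ]
  ring

/-- Monotone sequences of `n` natural numbers, at most `c`, exactly `p` of which are odd. -/
noncomputable def boundedParts (n c p : ℕ) : Finset (Fin n → ℕ) :=
  open Classical in
  (Fintype.piFinset fun _ => range (c + 1)).filter fun β =>
    Monotone β ∧ (univ.filter fun j => Odd (β j)).card = p

lemma mem_boundedParts {n c p : ℕ} {β : Fin n → ℕ} :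
    β ∈ boundedParts n c p ↔
      (∀ j, β j ≤ c) ∧ Monotone β ∧ (univ.filter fun j => Odd (β j)).card = p := by
  classical
  simp [boundedParts]

/-- The sum of the alternants over all sequences in `boundedParts n c p`. -/
noncomputable def altSum {n : ℕ} (c p : ℕ) (x : Fin n → K) : K :=
  ∑ β ∈ boundedParts n c p, alternant x β

/-- The part of `altSum` coming from sequences that start with zero. -/
noncomputable def altTail {n : ℕ} (c p : ℕ) (x : Fin (n + 1) → K) : K :=
  ∑ i : Fin (n + 1), (-1) ^ (i : ℕ) *
    ((∏ j, x (i.succAbove j)) * altSum c p fun j => x (i.succAbove j))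

lemma monotone_cons_zero {n : ℕ} {β : Fin n → ℕ} (h : Monotone β) :
    Monotone (Fin.cons 0 β : Fin (n + 1) → ℕ) := by
  intro i j hij
  induction i using Fin.cases with
  | zero => simp
  | succ i =>
    induction j using Fin.cases with
    | zero => simp at hij
    | succ j => simpa using h (by simpa using hij)

lemma card_odd_cons_zero {n : ℕ} (β : Fin n → ℕ) :
    (univ.filter fun j => Odd ((Fin.cons 0 β : Fin (n + 1) → ℕ) j)).card =
      (univ.filter fun j => Odd (β j)).card := by
  rw [Fin.card_filter_univ_succ]
  simp

lemma sum_boundedParts_first_zero {n : ℕ} (c p : ℕ) (x : Fin (n + 1) → K) :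
    ∑ β ∈ (boundedParts (n + 1) c p).filter (fun β => β 0 = 0), alternant x β =
      altTail c p x := by
  unfold altTail altSum
  simp_rw [mul_sum]
  rw [sum_comm]
  simp_rw [← alternant_cons_zero]
  refine sum_nbij' (fun β j => β j.succ) (fun β => Fin.cons 0 β) ?_ ?_ ?_ ?_ ?_
  · intro β hβ
    rw [mem_filter, mem_boundedParts] at hβ
    obtain ⟨⟨h1, h2, h3⟩, h0⟩ := hβ
    rw [mem_boundedParts]
    refine ⟨fun j => h1 _, fun i j hij => h2 (by simpa using hij), ?_⟩
    rw [← h3, Fin.card_filter_univ_succ]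
    simp [h0]
  · intro β hβ
    rw [mem_boundedParts] at hβ
    rw [mem_filter, mem_boundedParts]
    refine ⟨⟨fun j => ?_, monotone_cons_zero hβ.2.1, ?_⟩, rfl⟩
    · induction j using Fin.cases <;> simp [hβ.1]
    · rw [card_odd_cons_zero, hβ.2.2]
  · intro β hβ
    rw [mem_filter] at hβ
    ext j
    induction j using Fin.cases <;> simp [hβ.2]
  · intro β _
    ext j
    simp
  · intro β hβ
    rw [mem_filter] at hβ
    congr 1
    ext j
    induction j using Fin.cases <;> simp [hβ.2]

lemma card_odd_add_one {n : ℕ} (β : Fin n → ℕ) :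
    (univ.filter fun j => Odd (β j + 1)).card + (univ.filter fun j => Odd (β j)).card = n := by
  have h := card_filter_add_card_filter_not (s := (univ : Finset (Fin n))) fun j => Odd (β j)
  simp only [card_univ, Fintype.card_fin] at h
  have h2 : ∀ j, Odd (β j + 1) ↔ ¬ Odd (β j) := fun j => by grind
  simp_rw [h2]
  omega

lemma sum_boundedParts_first_ne_zero {n : ℕ} {c p s : ℕ} (hp : p + s = n + 1)
    (x : Fin (n + 1) → K) :
    ∑ β ∈ (boundedParts (n + 1) (c + 1) p).filter (fun β => ¬ β 0 = 0), alternant x β =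
      (∏ i, x i) * altSum c s x := by
  rw [altSum, mul_sum]
  simp_rw [← alternant_add_one]
  have key : ∀ β ∈ (boundedParts (n + 1) (c + 1) p).filter (fun β => ¬ β 0 = 0),
      (fun j => β j - 1 + 1) = β := by
    intro β hβ
    rw [mem_filter, mem_boundedParts] at hβ
    ext j
    have := hβ.1.2.1 (Fin.zero_le j)
    have := hβ.2
    omega
  refine sum_nbij' (fun β j => β j - 1) (fun β j => β j + 1) ?_ ?_ ?_ ?_ ?_
  · intro β hβ
    have hk := key β hβ
    rw [mem_filter, mem_boundedParts] at hβ
    obtain ⟨⟨h1, h2, h3⟩, h0⟩ := hβ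
    rw [mem_boundedParts]
    refine ⟨fun j => ?_, fun i j hij => ?_, ?_⟩
    · have := h1 j
      omega
    · exact Nat.sub_le_sub_right (h2 hij) 1
    · have h := card_odd_add_one fun j => β j - 1
      have h4 : (univ.filter fun j => Odd (β j - 1 + 1)).card = p := by
        rw [← h3]
        congr! with j
        exact congrFun hk j
      omega
  · intro β hβ
    rw [mem_boundedParts] at hβ
    rw [mem_filter, mem_boundedParts]
    refine ⟨⟨fun j => ?_, fun i j hij => ?_, ?_⟩, by simp⟩
    · have := hβ.1 j
      omega
    · exact Nat.add_le_add_right (hβ.2.1 hij) 1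
    · have := card_odd_add_one β
      have := hβ.2.2
      omega
  · exact key
  · intro β _
    ext j
    simp
  · intro β hβ
    rw [key β hβ]

lemma altSum_succ {n : ℕ} {c p s : ℕ} (hp : p + s = n + 1) (x : Fin (n + 1) → K) :
    altSum (c + 1) p x = (∏ i, x i) * altSum c s x + altTail (c + 1) p x := by
  rw [← sum_boundedParts_first_ne_zero hp, ← sum_boundedParts_first_zero, altSum]
  exact (sum_filter_not_add_sum_filter _ _ _).symm

lemma altSum_zero {n : ℕ} (p : ℕ) (x : Fin (n + 1) → K) :
    altSum 0 p x = altTail 0 p x := by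
  rw [← sum_boundedParts_first_zero, altSum, filter_true_of_mem]
  intro β hβ
  rw [mem_boundedParts] at hβ
  simpa using hβ.1 0

lemma altSum_eq_zero {n : ℕ} {c p : ℕ} (hp : n < p) (x : Fin n → K) : altSum c p x = 0 := by
  refine sum_eq_zero fun β hβ => ?_
  rw [mem_boundedParts] at hβ
  have := card_le_univ (univ.filter fun j => Odd (β j))
  simp only [Fintype.card_fin] at this
  omega

lemma alternant_eq_zero_of_eq_add_one {n : ℕ} (x : Fin (n + 1) → K) (β : Fin (n + 1) → ℕ)
    (i : Fin n) (h : β i.castSucc = β i.succ + 1) : alternant x β = 0 := by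
  refine Matrix.det_zero_of_row_eq (i := i.castSucc) (j := i.succ) Fin.castSucc_lt_succ.ne ?_
  ext j
  simp only [Matrix.of_apply, h, Fin.val_castSucc, Fin.val_succ]
  congr 1
  ring

lemma alternant_add_indicator_eq_zero {n : ℕ} (x : Fin n → K) {β : Fin n → ℕ}
    (hβ : Monotone β) (he : ∀ j, Even (β j)) (S : Finset (Fin n))
    (h : ¬ Monotone fun j => β j + if j ∈ S then 1 else 0) :
    alternant x (fun j => β j + if j ∈ S then 1 else 0) = 0 := by
  obtain _ | n := n
  · exact absurd (fun i => i.elim0) h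
  rw [Fin.monotone_iff_le_succ] at h
  push Not at h
  obtain ⟨i, hi⟩ := h
  refine alternant_eq_zero_of_eq_add_one x _ i ?_
  have h1 := hβ (Fin.castSucc_le_succ i)
  have := he i.castSucc
  have := he i.succ
  split_ifs at * <;> grind

lemma even_of_mem_boundedParts_zero {n c : ℕ} {β : Fin n → ℕ} (hβ : β ∈ boundedParts n c 0)
    (j : Fin n) : Even (β j) := by
  rw [mem_boundedParts, card_eq_zero, filter_eq_empty_iff] at hβ
  simpa using hβ.2.2 (mem_univ j)

lemma altSum_odd {n : ℕ} (k p : ℕ) (x : Fin n → K) :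
    altSum (2 * k + 1) p x = elemSymm p x * altSum (2 * k) 0 x := by
  classical
  unfold altSum
  rw [mul_sum]
  simp_rw [elemSymm_mul_alternant]
  rw [← sum_product']
  rw [← sum_filter_of_ne (p := fun z : (Fin n → ℕ) × Finset (Fin n) =>
    Monotone fun j => z.1 j + if j ∈ z.2 then 1 else 0)]
  swap
  · rintro ⟨β, S⟩ hz hne
    rw [mem_product] at hz
    by_contra hm
    exact hne (alternant_add_indicator_eq_zero x (mem_boundedParts.1 hz.1).2.1
      (even_of_mem_boundedParts_zero hz.1) S hm)
  symm
  refine sum_nbij' (fun z j => z.1 j + if j ∈ z.2 then 1 else 0)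
    (fun β => (fun j => β j - β j % 2, univ.filter fun j => Odd (β j))) ?_ ?_ ?_ ?_ ?_
  · rintro ⟨β, S⟩ hz
    rw [mem_filter, mem_product] at hz
    obtain ⟨⟨h1, h2⟩, hm⟩ := hz
    have he := even_of_mem_boundedParts_zero h1
    dsimp only at h1 h2 hm he ⊢
    rw [mem_boundedParts] at h1
    rw [mem_powersetCard] at h2
    rw [mem_boundedParts]
    refine ⟨fun j => ?_, hm, ?_⟩
    · have := h1.1 j
      split_ifs <;> omega
    · rw [← h2.2]
      congr 1
      ext j
      have := he j
      simp only [mem_filter, mem_univ, true_and]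
      split_ifs <;> grind
  · intro β hβ
    rw [mem_boundedParts] at hβ
    obtain ⟨h1, h2, h3⟩ := hβ
    rw [mem_filter, mem_product, mem_boundedParts, mem_powersetCard]
    have hb : (fun j => β j - β j % 2 + if j ∈ univ.filter fun j => Odd (β j) then 1 else 0)
        = β := by
      ext j
      simp only [mem_filter, mem_univ, true_and]
      split_ifs <;> grind
    refine ⟨⟨⟨fun j => ?_, fun i j hij => ?_, ?_⟩, subset_univ _, h3⟩, ?_⟩
    · have := h1 j
      dsimp only
      omega
    · have := h2 hij
      dsimp only
      omega
    · rw [card_eq_zero, filter_eq_empty_iff]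
      intro j _
      dsimp only
      grind
    · dsimp only
      rw [hb]
      exact h2
  · rintro ⟨β, S⟩ hz
    rw [mem_filter, mem_product] at hz
    have he := even_of_mem_boundedParts_zero hz.1.1
    dsimp only at he ⊢
    refine Prod.ext (funext fun j => ?_) (Finset.ext fun j => ?_)
    · have := he j
      dsimp only
      split_ifs <;> grind
    · have := he j
      simp only [mem_filter, mem_univ, true_and]
      split_ifs <;> grind
  · intro β _
    ext j
    simp only [mem_filter, mem_univ, true_and]
    split_ifs <;> grind
  · rintro ⟨β, S⟩ _
    rfl

lemma prod_Ici_eq_prod_mul_prod_Ioi {M : Type*} [CommMonoid M] {n : ℕ} (f : Fin n → M)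
    (i : Fin n) : ∏ j ∈ Ici i, f j = f i * ∏ j ∈ Ioi i, f j := by
  rw [← Ioi_insert, prod_insert (by simp)]

/-- Splitting the factors that involve the index `p` off a product over unordered pairs. -/
lemma prod_pairs_succAbove {M : Type*} [CommMonoid M] {n : ℕ} (g : Fin (n + 1) → Fin (n + 1) → M)
    (hg : ∀ i j, g i j = g j i) (p : Fin (n + 1)) :
    ∏ i, ∏ j ∈ Ici i, g i j =
      (∏ j, g p j) * ∏ i, ∏ j ∈ Ici i, g (p.succAbove i) (p.succAbove j) := by
  have h1 : ∀ i : Fin (n + 1), ∏ j ∈ Ici i, g i j = ∏ j, if i ≤ j then g i j else 1 := by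
    intro i
    rw [← prod_filter]
    congr 1
    ext
    simp
  have h2 : ∀ i : Fin n, ∏ j ∈ Ici i, g (p.succAbove i) (p.succAbove j) =
      ∏ j, if i ≤ j then g (p.succAbove i) (p.succAbove j) else 1 := by
    intro i
    rw [← prod_filter]
    congr 1
    ext
    simp
  simp_rw [h1, h2]
  rw [Fin.prod_univ_succAbove _ p]
  simp_rw [Fin.prod_univ_succAbove _ p, prod_mul_distrib]
  rw [← mul_assoc]
  simp only [Fin.succAbove_le_succAbove_iff, le_refl, if_true]
  congr 1
  rw [mul_assoc, ← prod_mul_distrib]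
  congr 1
  refine prod_congr rfl fun j _ => ?_
  rcases lt_or_gt_of_ne (Fin.succAbove_ne p j) with h | h
  · rw [if_neg (not_le.2 h), if_pos h.le, one_mul, hg]
  · rw [if_pos h.le, if_neg (not_le.2 h), mul_one]

/-- The denominator `∏_{i ≤ j} (1 - x i * x j)`. -/
def pairProd {n : ℕ} (x : Fin n → K) : K := ∏ i, ∏ j ∈ Ici i, (1 - x i * x j)

lemma pairProd_succAbove {n : ℕ} (x : Fin (n + 1) → K) (i : Fin (n + 1)) :
    pairProd x = (∏ j, (1 - x i * x j)) * pairProd fun j => x (i.succAbove j) :=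
  prod_pairs_succAbove (fun i j => 1 - x i * x j) (fun i j => by rw [mul_comm]) i

/-- The entries of the symplectic determinant. -/
def sympEntry {n : ℕ} (x : Fin n → K) (k e : ℕ) (i : Fin n) : K :=
  x i ^ e - x i ^ (2 * k + 2 * n - e)

/-- The determinant with rows `sympEntry x k e`, where `e` runs through `{0, …, n} \ {s}`. -/
def sympDet {n : ℕ} (x : Fin n → K) (k : ℕ) (s : Fin (n + 1)) : K :=
  (Matrix.of fun j : Fin n => sympEntry x k (s.succAbove j)).det

lemma prod_one_sub_eq_sum_sympEntry {n : ℕ} (x : Fin n → K) (k : ℕ) (i : Fin n) :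
    ∏ j, (1 - x i * x j) =
      ∑ r ∈ range (n + 1), (-1) ^ r * elemSymm r x * sympEntry x k r i := by
  have h0 : ∑ r ∈ range (n + 1), (-1) ^ r * elemSymm r x * (x i ^ (n - r) * 1 ^ r) = 0 := by
    rw [← prod_sub_mul_eq_sum_elemSymm]
    exact prod_eq_zero (mem_univ i) (by ring)
  rw [prod_sub_mul_eq_sum_elemSymm, ← sub_zero (∑ r ∈ range (n + 1), _),
    ← mul_zero (x i ^ (2 * k + n)), ← h0, mul_sum, ← sum_sub_distrib]
  refine sum_congr rfl fun r hr => ?_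
  have hr' : r ≤ n := Nat.lt_succ_iff.1 (mem_range.1 hr)
  have : 2 * k + 2 * n - r = (2 * k + n) + (n - r) := by omega
  rw [sympEntry, this, pow_add]
  ring

lemma det_cons_eq_sum {n : ℕ} (v : Fin (n + 1) → K) (w : Fin n → Fin (n + 1) → K) :
    (Matrix.of (Fin.cons v w : Fin (n + 1) → Fin (n + 1) → K)).det =
      ∑ i : Fin (n + 1), (-1) ^ (i : ℕ) * v i *
        (Matrix.of fun j l => w j (i.succAbove l)).det := by
  rw [Matrix.det_succ_row_zero]
  rfl

lemma det_cons_sum {n : ℕ} (t : Finset ℕ) (a : ℕ → K) (c : ℕ → Fin (n + 1) → K)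
    (w : Fin n → Fin (n + 1) → K) :
    (Matrix.of (Fin.cons (fun i => ∑ r ∈ t, a r * c r i) w :
      Fin (n + 1) → Fin (n + 1) → K)).det =
      ∑ r ∈ t, a r * (Matrix.of (Fin.cons (c r) w : Fin (n + 1) → Fin (n + 1) → K)).det := by
  simp_rw [det_cons_eq_sum, mul_sum, sum_mul]
  rw [sum_comm]
  exact sum_congr rfl fun r _ => sum_congr rfl fun i _ => by ring

lemma sum_mul_sympDet {n : ℕ} (x : Fin (n + 1) → K) (k : ℕ) (s : Fin (n + 1)) :
    ∑ i : Fin (n + 1), (-1) ^ (i : ℕ) * (∏ j, (1 - x i * x j)) *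
      (Matrix.of fun (j : Fin n) l =>
        sympEntry x k ((s.succAbove j : ℕ) + 1) (i.succAbove l)).det =
      sympDet x k s.succ - elemSymm (s + 1) x * sympDet x k 0 := by
  simp_rw [prod_one_sub_eq_sum_sympEntry x k]
  rw [← det_cons_eq_sum _ fun j => sympEntry x k ((s.succAbove j : ℕ) + 1), det_cons_sum,
    sum_range_succ']
  rw [sum_eq_single (s : ℕ)]
  · have h1 : (Matrix.of (Fin.cons (sympEntry x k (s + 1)) fun j : Fin n =>
        sympEntry x k ((s.succAbove j : ℕ) + 1) : Fin (n + 1) → Fin (n + 1) → K)).det =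
        (-1) ^ (s : ℕ) * sympDet x k 0 := by
      rw [det_cons_eq_sum, sympDet, Matrix.det_succ_row _ s, mul_sum]
      refine sum_congr rfl fun i _ => ?_
      have hs : ((-1 : K) ^ (s : ℕ)) * (-1) ^ (s : ℕ) = 1 := by
        rw [← mul_pow]
        simp
      rw [pow_add]
      simp only [Matrix.of_apply, Fin.zero_succAbove, Fin.val_succ]
      have h2 : (Matrix.of fun j : Fin (n + 1) => sympEntry x k ((j : ℕ) + 1)).submatrix
          s.succAbove i.succAbove = Matrix.of fun (j : Fin n) l =>
            sympEntry x k ((s.succAbove j : ℕ) + 1) (i.succAbove l) := rfl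
      rw [h2]
      linear_combination (-(-1) ^ (i : ℕ) * sympEntry x k (s + 1) i * (Matrix.of fun (j : Fin n) l =>
            sympEntry x k ((s.succAbove j : ℕ) + 1) (i.succAbove l)).det) * hs
    have h3 : (Matrix.of (Fin.cons (sympEntry x k 0) fun j : Fin n =>
        sympEntry x k ((s.succAbove j : ℕ) + 1) : Fin (n + 1) → Fin (n + 1) → K)).det =
        sympDet x k s.succ := by
      rw [sympDet]
      congr 1
      ext j i
      induction j using Fin.cases with
      | zero => simp
      | succ j => simp
    have hs : ((-1 : K) ^ (s : ℕ)) * (-1) ^ (s : ℕ) = 1 := by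
      rw [← mul_pow]
      simp
    have h0 : elemSymm 0 x = 1 := by simp [elemSymm]
    rw [h1, h3, h0, pow_succ]
    linear_combination (-elemSymm (s + 1) x * sympDet x k 0) * hs
  · intro r hr hne
    rw [mem_range] at hr
    obtain ⟨j, hj⟩ := Fin.exists_succAbove_eq (x := ⟨r, hr⟩) (y := s)
      (fun h => hne (congrArg Fin.val h))
    rw [Matrix.det_zero_of_row_eq (i := 0) (j := j.succ) (Fin.succ_ne_zero j).symm, mul_zero]
    ext i
    simp [hj]
  · intro h
    exact absurd (mem_range.2 s.isLt) h

lemma prod_mul_sympDet {n : ℕ} (x : Fin n → K) (k : ℕ) (s : Fin (n + 1)) :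
    (∏ i, x i) * sympDet x k s = (Matrix.of fun (j : Fin n) i =>
      x i ^ ((s.succAbove j : ℕ) + 1) - x i ^ (2 * k + 2 * n - (s.succAbove j : ℕ) + 1)).det := by
  rw [sympDet, ← Matrix.det_mul_row]
  congr 1
  ext j i
  simp only [Matrix.of_apply, sympEntry]
  ring

lemma prod_mul_sympDet_last {n : ℕ} (x : Fin n → K) (k : ℕ) :
    (∏ i, x i) * sympDet x k (Fin.last n) = sympDet x (k + 1) 0 := by
  rw [prod_mul_sympDet, sympDet]
  congr 1
  ext j i
  simp only [Matrix.of_apply, sympEntry, Fin.succAbove_last, Fin.val_castSucc,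
    Fin.zero_succAbove, Fin.val_succ]
  congr 2
  omega

lemma sympDet_zero_zero {n : ℕ} (x : Fin (n + 1) → K) : sympDet x 0 0 = 0 := by
  refine Matrix.det_eq_zero_of_row_eq_zero (Fin.last n) fun i => ?_
  simp only [Matrix.of_apply, sympEntry, Fin.zero_succAbove, Fin.val_succ, Fin.val_last]
  rw [sub_eq_zero]
  congr 1
  omega

lemma altTail_mul_pairProd {n : ℕ} {k p s : ℕ} (hs : s ≤ n + 1) (hp : p + s = n + 1)
    (ih : ∀ (s' : Fin (n + 1)) (y : Fin n → K), p + s' = n →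
      altSum (2 * k) p y * pairProd y = sympDet y k s')
    (x : Fin (n + 1) → K) :
    altTail (2 * k) p x * pairProd x =
      sympDet x k ⟨s, Nat.lt_succ_of_le hs⟩ - elemSymm s x * sympDet x k 0 := by
  obtain _ | s := s
  · have h0 : elemSymm 0 x = 1 := by simp [elemSymm]
    have h1 : altTail (2 * k) p x = 0 := by
      refine sum_eq_zero fun i _ => ?_
      rw [altSum_eq_zero (by omega)]
      ring
    rw [h0, h1]
    simp
  · have h1 := sum_mul_sympDet x k ⟨s, by omega⟩
    rw [Fin.succ_mk] at h1
    rw [← h1, altTail, sum_mul]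
    refine sum_congr rfl fun i _ => ?_
    rw [pairProd_succAbove x i]
    have h2 := ih ⟨s, by omega⟩ (fun j => x (i.succAbove j)) (by simp; omega)
    have h3 := prod_mul_sympDet (fun j => x (i.succAbove j)) k ⟨s, by omega⟩
    have h4 : (Matrix.of fun (j : Fin n) l => sympEntry x k
        (((⟨s, by omega⟩ : Fin (n + 1)).succAbove j : ℕ) + 1) (i.succAbove l)).det =
        (∏ j, x (i.succAbove j)) * (altSum (2 * k) p (fun j => x (i.succAbove j)) *
          pairProd fun j => x (i.succAbove j)) := by
      rw [h2, h3]
      congr 1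
      ext j l
      simp only [Matrix.of_apply, sympEntry]
      congr 2
      have := ((⟨s, by omega⟩ : Fin (n + 1)).succAbove j).isLt
      omega
    rw [h4]
    ring

/-- The bounded Littlewood identity refined by the number of odd parts. -/
theorem altSum_even_mul_pairProd (n : ℕ) : ∀ (k p : ℕ) (s : Fin (n + 1)) (x : Fin n → K),
    p + s = n → altSum (2 * k) p x * pairProd x = sympDet x k s := by
  induction n with
  | zero =>
    intro k p s x hp
    have hb : boundedParts 0 (2 * k) 0 = {fun i => i.elim0} := by
      ext β
      rw [mem_boundedParts, mem_singleton]
      exact ⟨fun _ => Subsingleton.elim _ _, fun _ => ⟨fun i => i.elim0, fun i => i.elim0, by simp⟩⟩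
    obtain rfl : p = 0 := by omega
    simp [altSum, pairProd, sympDet, alternant, hb]
  | succ n ih =>
    intro k
    induction k with
    | zero =>
      intro p s x hp
      rw [mul_zero, altSum_zero]
      have := altTail_mul_pairProd (k := 0) (by omega) hp (fun s' y h => ih 0 p s' y h) x
      rw [mul_zero] at this
      rw [this, sympDet_zero_zero]
      simp
    | succ k ihk =>
      intro p s x hp
      have h1 := altTail_mul_pairProd (k := k + 1) (by omega) hp (fun s' y h => ih _ p s' y h) x
      have h2 : 2 * (k + 1) = 2 * k + 1 + 1 := by ring
      rw [h2, altSum_succ hp, ← h2, add_mul, h1, altSum_odd]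
      have h3 := ihk 0 (Fin.last _) x (by simp)
      have h4 := prod_mul_sympDet_last x k
      rw [← h3] at h4
      rw [← h4]
      ring

end Alternants
/-! ### Strict plane partitions of a given shape -/

section PrincipalSpecialization

variable {K : Type*} [CommRing K]

lemma pow_sub_pow_eq_mul_sum_Icc (y : K) {a b : ℕ} (h : a ≤ b) (j : ℕ) :
    y ^ (b + (j + 1)) - y ^ (a + j) = (y - 1) * ∑ m ∈ Icc a b, y ^ (m + j) := by
  have h1 : ∑ m ∈ Icc a b, y ^ (m + j) = y ^ j * ∑ m ∈ Ico a (b + 1), y ^ m := by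
    rw [mul_sum]
    exact sum_congr rfl fun m _ => by ring
  rw [h1]
  linear_combination -y ^ j * geom_sum_Ico_mul y (show a ≤ b + 1 by omega)

/-- The weakly increasing sequences that interlace with `β`. -/
def interlacing {n : ℕ} (β : Fin (n + 1) → ℕ) : Finset (Fin n → ℕ) :=
  Fintype.piFinset fun j => Icc (β j.castSucc) (β j.succ)

/-- The branching rule for principally specialized alternants. -/
lemma alternant_branching {n : ℕ} (t : K) {β : Fin (n + 1) → ℕ} (hβ : Monotone β) :
    alternant (fun i : Fin (n + 1) => t ^ ((i : ℕ) + 1)) β =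
      t ^ (∑ j, β j) * ((∏ j : Fin (n + 1), t ^ (j : ℕ)) * (∏ i : Fin n, (t ^ ((i : ℕ) + 1) - 1)) *
        ∑ γ ∈ interlacing β, alternant (fun i : Fin n => t ^ ((i : ℕ) + 1)) γ) := by
  have h1 : alternant (fun i : Fin (n + 1) => t ^ ((i : ℕ) + 1)) β =
      (∏ j : Fin (n + 1), t ^ (β j + j)) *
        (Matrix.of fun j i : Fin (n + 1) => (t ^ (i : ℕ)) ^ (β j + j)).det := by
    rw [alternant, ← Matrix.det_mul_column]
    congr 1
    ext j i
    simp only [Matrix.of_apply]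
    ring
  have h2 : (Matrix.of fun j i : Fin (n + 1) => (t ^ (i : ℕ)) ^ (β j + j)).det =
      (Matrix.of fun j i : Fin n => (t ^ ((i : ℕ) + 1)) ^ (β j.succ + (j + 1)) -
        (t ^ ((i : ℕ) + 1)) ^ (β j.castSucc + j)).det := by
    rw [Matrix.det_eq_of_forall_row_eq_smul_add_pred (B := Matrix.of fun j i =>
      Fin.cons (α := fun _ => K) ((t ^ (i : ℕ)) ^ (β 0 + 0)) (fun j : Fin n =>
        (t ^ (i : ℕ)) ^ (β j.succ + (j + 1)) - (t ^ (i : ℕ)) ^ (β j.castSucc + j)) j)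
      (fun _ => 1)]
    · rw [Matrix.det_succ_column_zero, sum_eq_single 0]
      · simp
        rfl
      · intro i _ hi
        obtain ⟨j, rfl⟩ := Fin.exists_succ_eq_of_ne_zero hi
        simp
      · simp
    · intro j
      simp
    · intro i j
      simp
  rw [h1, h2]
  simp_rw [fun (y : K) (j : Fin n) =>
    pow_sub_pow_eq_mul_sum_Icc y (hβ (Fin.castSucc_le_succ j)) (j : ℕ)]
  simp_rw [pow_add t (β _), prod_mul_distrib, prod_pow_eq_pow_sum]
  have h3 : (Matrix.of fun j i : Fin n => ∑ m ∈ Icc (β j.castSucc) (β j.succ),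
      (t ^ ((i : ℕ) + 1)) ^ (m + j)).det =
      ∑ γ ∈ interlacing β, alternant (fun i : Fin n => t ^ ((i : ℕ) + 1)) γ := by
    have := (Matrix.detRowAlternating (R := K) (n := Fin n)).toMultilinearMap.map_sum_finset
      (fun (j : Fin n) m => fun i : Fin n => (t ^ ((i : ℕ) + 1)) ^ (m + (j : ℕ)))
      (fun j => Icc (β j.castSucc) (β j.succ))
    refine Eq.trans ?_ this
    change Matrix.det _ = Matrix.det _
    congr 1
    ext j i
    simp
  have h4 := Matrix.det_mul_row (fun i : Fin n => t ^ ((i : ℕ) + 1) - 1)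
    (Matrix.of fun j i : Fin n => ∑ m ∈ Icc (β j.castSucc) (β j.succ),
      (t ^ ((i : ℕ) + 1)) ^ (m + j))
  simp only [Matrix.of_apply] at h4
  rw [h4, h3]
  ring

end PrincipalSpecialization

namespace SPP

@[ext]
lemma ext {P Q : SPP} (h : ∀ i j, P.part i j = Q.part i j) : P = Q := by
  cases P
  cases Q
  congr
  ext i j
  exact h i j

lemma part_ne_zero_iff (P : SPP) (i j : ℕ) : P.part i j ≠ 0 ↔ j < rowLen P i := by
  have hfin : {j | P.part i j ≠ 0}.Finite :=
    P.supp_finite.preimage (f := fun j => (i, j)) (Function.Injective.injOn fun a b h => by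
      simpa using h)
  obtain ⟨m, hm⟩ : ∃ m, {j | P.part i j ≠ 0} = Set.Iio m := by
    classical
    obtain ⟨b, hb⟩ := hfin.bddAbove
    have hex : ∃ m, P.part i m = 0 := ⟨b + 1, by
      by_contra h
      have := hb h
      omega⟩
    refine ⟨Nat.find hex, Set.ext fun j => ?_⟩
    simp only [Set.mem_ofPred_eq, Set.mem_Iio, Nat.lt_find_iff]
    refine ⟨fun h l hl hl0 => h ?_, fun h => h j le_rfl⟩
    have := P.row_decr i l j hl
    omega
  have hlen : rowLen P i = m := by
    rw [rowLen, hm, Set.ncard_eq_toFinset_card']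
    simp
  rw [hlen]
  exact Set.ext_iff.1 hm j

lemma rowLen_eq_of_forall {P : SPP} {i m : ℕ} (h : ∀ j, P.part i j ≠ 0 ↔ j < m) :
    rowLen P i = m := by
  have h1 : ∀ j, j < rowLen P i ↔ j < m := fun j => by rw [← part_ne_zero_iff, h]
  have := h1 m
  have := h1 (rowLen P i)
  omega

lemma part_add_row_le (P : SPP) {n : ℕ} (hn : ∀ i j, P.part i j ≤ n) (i j : ℕ)
    (h : P.part i j ≠ 0) : P.part i j + i ≤ n := by
  induction i with
  | zero => exact hn 0 j
  | succ i ih =>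
    have h1 := P.col_strict i j h
    have := ih (by omega)
    omega

lemma rowLen_eq_zero (P : SPP) {n : ℕ} (hn : ∀ i j, P.part i j ≤ n) {i : ℕ} (hi : n ≤ i) :
    rowLen P i = 0 := by
  refine rowLen_eq_of_forall fun j => ⟨fun h => ?_, fun h => absurd h (Nat.not_lt_zero _)⟩
  have := P.part_add_row_le hn i j h
  omega

/-- Subtract one from every part. -/
def decrease (P : SPP) : SPP where
  part i j := P.part i j - 1
  supp_finite := P.supp_finite.subset fun ij h => by
    simp only [Set.mem_ofPred_eq] at h ⊢
    omega
  row_decr i j₁ j₂ h := Nat.sub_le_sub_right (P.row_decr i j₁ j₂ h) 1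
  col_strict i j h := by
    have := P.col_strict i j (by omega)
    omega

/-- Add one to every entry of a shape containing the shape of `P`. -/
def increase (P : SPP) (l : ℕ → ℕ) (hl : {i | l i ≠ 0}.Finite) (h₁ : ∀ i, rowLen P i ≤ l i)
    (h₂ : ∀ i, l (i + 1) ≤ rowLen P i) : SPP where
  part i j := if j < l i then P.part i j + 1 else 0
  supp_finite := by
    refine (hl.biUnion fun i _ => (Set.finite_singleton i).prod (Set.finite_Iio (l i))).subset ?_
    rintro ⟨i, j⟩ h
    simp only [Set.mem_ofPred_eq, ne_eq, ite_eq_right_iff, Classical.not_imp] at h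
    simp only [Set.mem_iUnion, Set.mem_prod, Set.mem_singleton_iff, Set.mem_Iio, Set.mem_ofPred_eq]
    exact ⟨i, by omega, rfl, h.1⟩
  row_decr i j₁ j₂ h := by
    have := P.row_decr i j₁ j₂ h
    split_ifs <;> omega
  col_strict i j h := by
    have h3 : j < l (i + 1) := by
      by_contra h4
      exact h (if_neg h4)
    have h4 := h₂ i
    have h5 := h₁ i
    have h6 := (P.part_ne_zero_iff i j).2 (by omega)
    have h7 := P.col_strict i j
    rw [if_pos h3, if_pos (by omega)]
    omega

lemma rowLen_increase (P : SPP) (l : ℕ → ℕ) (hl h₁ h₂) : rowLen (P.increase l hl h₁ h₂) = l := by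
  ext i
  refine rowLen_eq_of_forall fun j => ?_
  simp [increase]

lemma decrease_increase (P : SPP) (l : ℕ → ℕ) (hl h₁ h₂) :
    (P.increase l hl h₁ h₂).decrease = P := by
  ext i j
  simp only [decrease, increase]
  split_ifs with h
  · rfl
  · have := P.part_ne_zero_iff i j
    have := h₁ i
    omega

lemma rowLen_decrease_le (P : SPP) (i : ℕ) : rowLen P.decrease i ≤ rowLen P i := by
  by_contra! h
  have h1 := (P.decrease.part_ne_zero_iff i _).2 h
  have h2 := P.part_ne_zero_iff i (rowLen P i)
  simp only [decrease] at h1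
  omega

lemma rowLen_succ_le_rowLen_decrease (P : SPP) (i : ℕ) :
    rowLen P (i + 1) ≤ rowLen P.decrease i := by
  by_contra! h
  have h1 := (P.part_ne_zero_iff (i + 1) _).2 h
  have h2 := P.decrease.part_ne_zero_iff i (rowLen P.decrease i)
  have h3 := P.col_strict i _ h1
  have h4 : P.decrease.part i (rowLen P.decrease i) = P.part i (rowLen P.decrease i) - 1 := rfl
  rw [h4] at h2
  omega

lemma eq_of_decrease_eq {P Q : SPP} (h : P.decrease = Q.decrease)
    (hl : ∀ i, rowLen P i = rowLen Q i) : P = Q := by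
  ext i j
  have h1 : P.part i j - 1 = Q.part i j - 1 := congrArg (fun R : SPP => R.part i j) h
  have h2 := P.part_ne_zero_iff i j
  have h3 := Q.part_ne_zero_iff i j
  rw [hl i] at h2
  omega

lemma sppNorm_eq_add (P : SPP) {n : ℕ} (hn : ∀ i j, P.part i j ≤ n) :
    sppNorm P = ∑ i ∈ range n, rowLen P i + sppNorm P.decrease := by
  have h1 : ∀ ij : ℕ × ℕ, P.part ij.1 ij.2 =
      (if ij.2 < rowLen P ij.1 then 1 else 0) + P.decrease.part ij.1 ij.2 := by
    intro ij
    have := P.part_ne_zero_iff ij.1 ij.2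
    simp only [decrease]
    split_ifs <;> omega
  have h2 : Function.support (fun ij : ℕ × ℕ => if ij.2 < rowLen P ij.1 then 1 else 0) ⊆
      (((range n) ×ˢ range (∑ i ∈ range n, rowLen P i) : Finset (ℕ × ℕ)) : Set (ℕ × ℕ)) := by
    rintro ⟨i, j⟩ h
    simp only [Function.mem_support, ne_eq, ite_eq_right_iff, one_ne_zero, imp_false,
      not_not] at h
    have hi : i ∈ range n := by
      by_contra hi
      rw [mem_range, not_lt] at hi
      rw [P.rowLen_eq_zero hn hi] at h
      omega
    have := single_le_sum (f := rowLen P) (fun _ _ => Nat.zero_le _) hi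
    rw [mem_coe, mem_product]
    exact ⟨hi, mem_range.2 (by dsimp only; omega)⟩
  rw [sppNorm, finsum_congr h1, finsum_add_distrib ((finite_toSet _).subset h2)
    P.decrease.supp_finite, finsum_eq_sum_of_support_subset _ h2, sum_product]
  congr 1
  refine sum_congr rfl fun i hi => ?_
  have := single_le_sum (f := rowLen P) (fun _ _ => Nat.zero_le _) hi
  rw [← sum_filter, sum_const, smul_eq_mul, mul_one]
  have h3 : (range (∑ i ∈ range n, rowLen P i)).filter (fun j => j < rowLen P i) =
      range (rowLen P i) := by
    ext j
    simp only [mem_filter, mem_range]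
    omega
  rw [h3, card_range]

/-- The strict plane partitions with parts at most `n` whose row lengths, read from the `n`-th row
upwards, are given by `β`. -/
def ofShape {n : ℕ} (β : Fin n → ℕ) : Set SPP :=
  {P | (∀ i j, P.part i j ≤ n) ∧ ∀ i : Fin n, rowLen P (n - 1 - i) = β i}

lemma sum_rowLen_of_mem_ofShape {n : ℕ} {β : Fin n → ℕ} {P : SPP} (h : P ∈ ofShape β) :
    ∑ i ∈ range n, rowLen P i = ∑ i, β i := by
  rw [← sum_range_reflect, ← Fin.sum_univ_eq_sum_range (fun i => rowLen P (n - 1 - i))]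
  exact sum_congr rfl fun i _ => h.2 i

lemma rowLen_eq_of_mem_ofShape {n : ℕ} {β : Fin n → ℕ} {P Q : SPP} (hP : P ∈ ofShape β)
    (hQ : Q ∈ ofShape β) (i : ℕ) : rowLen P i = rowLen Q i := by
  rcases lt_or_ge i n with h | h
  · have h1 := hP.2 ⟨n - 1 - i, by omega⟩
    have h2 := hQ.2 ⟨n - 1 - i, by omega⟩
    simp only [show n - 1 - (n - 1 - i) = i by omega] at h1 h2
    rw [h1, h2]
  · rw [P.rowLen_eq_zero hP.1 h, Q.rowLen_eq_zero hQ.1 h]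

lemma decrease_mem_ofShape {n : ℕ} {β : Fin (n + 1) → ℕ} {P : SPP} (hP : P ∈ ofShape β) :
    ∃ γ ∈ interlacing β, P.decrease ∈ ofShape γ := by
  refine ⟨fun i => rowLen P.decrease (n - 1 - i), ?_, fun i j => ?_, fun i => rfl⟩
  · refine Fintype.mem_piFinset.2 fun i => mem_Icc.2 ?_
    rw [← hP.2, ← hP.2]
    have h1 := P.rowLen_decrease_le (n - 1 - i)
    have h2 := P.rowLen_succ_le_rowLen_decrease (n - 1 - i)
    simp only [Fin.val_castSucc, Fin.val_succ]
    rw [show n + 1 - 1 - (i : ℕ) = n - 1 - i + 1 by omega,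
      show n + 1 - 1 - ((i : ℕ) + 1) = n - 1 - i by omega]
    exact ⟨h2, h1⟩
  · have := hP.1 i j
    simp only [decrease]
    omega

lemma exists_decrease_eq {n : ℕ} {β : Fin (n + 1) → ℕ} {γ : Fin n → ℕ} (hγ : γ ∈ interlacing β)
    {Q : SPP} (hQ : Q ∈ ofShape γ) : ∃ P ∈ ofShape β, P.decrease = Q := by
  have hγ' := fun i => mem_Icc.1 (Fintype.mem_piFinset.1 hγ i)
  have hl : {i | (if h : i < n + 1 then β ⟨n - i, by omega⟩ else 0) ≠ 0}.Finite := by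
    refine (Set.finite_Iio (n + 1)).subset fun i h => ?_
    by_contra h'
    exact h (dif_neg h')
  have hrow : ∀ i (h : i < n), rowLen Q i = γ ⟨n - 1 - i, by omega⟩ := by
    intro i h
    rw [← hQ.2]
    congr 1
    dsimp only
    omega
  have h₁ : ∀ i, rowLen Q i ≤ if h : i < n + 1 then β ⟨n - i, by omega⟩ else 0 := by
    intro i
    rcases lt_or_ge i n with h | h
    · rw [dif_pos (by omega), hrow i h]
      refine (hγ' ⟨n - 1 - i, by omega⟩).2.trans_eq (congrArg β (Fin.ext ?_))
      rw [Fin.val_succ]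
      dsimp only
      omega
    · rw [Q.rowLen_eq_zero hQ.1 h]
      exact Nat.zero_le _
  have h₂ : ∀ i, (if h : i + 1 < n + 1 then β ⟨n - (i + 1), by omega⟩ else 0) ≤ rowLen Q i := by
    intro i
    split_ifs with h
    · rw [hrow i (by omega)]
      refine (congrArg β (Fin.ext ?_)).trans_le (hγ' ⟨n - 1 - i, by omega⟩).1
      rw [Fin.val_castSucc]
      dsimp only
      omega
    · exact Nat.zero_le _
  refine ⟨Q.increase _ hl h₁ h₂, ⟨fun i j => ?_, fun i => ?_⟩, Q.decrease_increase _ _ _ _⟩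
  · have := hQ.1 i j
    simp only [increase]
    split_ifs <;> omega
  · rw [rowLen_increase, dif_pos (by omega)]
    congr 1
    ext
    dsimp only
    omega

lemma monotone_of_mem_interlacing {n : ℕ} {β : Fin (n + 1) → ℕ} {γ : Fin n → ℕ}
    (hγ : γ ∈ interlacing β) : Monotone γ := by
  have hγ' := fun i => mem_Icc.1 (Fintype.mem_piFinset.1 hγ i)
  obtain _ | n := n
  · exact fun i => i.elim0
  · rw [Fin.monotone_iff_le_succ]
    intro i
    refine (hγ' _).2.trans ?_
    rw [Fin.succ_castSucc]
    exact (hγ' _).1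

lemma eq_of_mem_ofShape {n : ℕ} {β γ : Fin n → ℕ} {P : SPP} (h₁ : P ∈ ofShape β)
    (h₂ : P ∈ ofShape γ) : β = γ :=
  funext fun i => (h₁.2 i).symm.trans (h₂.2 i)

/-- The generating function of strict plane partitions of a given shape. -/
theorem exists_finset_ofShape (n : ℕ) : ∀ β : Fin n → ℕ, Monotone β →
    ∃ T : Finset SPP, (T : Set SPP) = ofShape β ∧
      (∑ P ∈ T, q ^ sppNorm P) * alternant (fun i : Fin n => q ^ ((i : ℕ) + 1)) 0 =
        alternant (fun i : Fin n => q ^ ((i : ℕ) + 1)) β := by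
  classical
  induction n with
  | zero =>
    intro β _
    let Z : SPP := ⟨fun _ _ => 0, by simp, by simp, by simp⟩
    refine ⟨{Z}, ?_, ?_⟩
    · ext P
      simp only [coe_singleton, Set.mem_singleton_iff]
      constructor
      · rintro rfl
        exact ⟨fun _ _ => le_rfl, fun i => i.elim0⟩
      · intro h
        ext i j
        exact Nat.le_zero.1 (h.1 i j)
    · simp [sppNorm, Z, alternant]
  | succ n ih =>
    have ih' : ∀ γ : Fin n → ℕ, ∃ T : Finset SPP, Monotone γ → (T : Set SPP) = ofShape γ ∧
        (∑ P ∈ T, q ^ sppNorm P) * alternant (fun i : Fin n => q ^ ((i : ℕ) + 1)) 0 =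
          alternant (fun i : Fin n => q ^ ((i : ℕ) + 1)) γ := by
      intro γ
      by_cases h : Monotone γ
      · obtain ⟨T, hT⟩ := ih γ h
        exact ⟨T, fun _ => hT⟩
      · exact ⟨∅, fun h' => absurd h' h⟩
    choose T hT using ih'
    intro β hβ
    have hmem : ∀ γ ∈ interlacing β, ∀ P, P ∈ T γ ↔ P ∈ ofShape γ := by
      intro γ hγ P
      rw [← (hT γ (monotone_of_mem_interlacing hγ)).1, mem_coe]
    have himage : decrease '' ofShape β = ((interlacing β).biUnion T : Finset SPP) := by
      ext Q
      simp only [Set.mem_image, coe_biUnion, Set.mem_iUnion, mem_coe, exists_prop]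
      constructor
      · rintro ⟨P, hP, rfl⟩
        obtain ⟨γ, hγ, h⟩ := decrease_mem_ofShape hP
        exact ⟨γ, hγ, (hmem γ hγ _).2 h⟩
      · rintro ⟨γ, hγ, h⟩
        exact exists_decrease_eq hγ ((hmem γ hγ _).1 h)
    have hinj : Set.InjOn decrease (ofShape β) := fun P hP Q hQ h =>
      eq_of_decrease_eq h (rowLen_eq_of_mem_ofShape hP hQ)
    have hfin : (ofShape β).Finite := by
      refine Set.Finite.of_finite_image ?_ hinj
      rw [himage]
      exact finite_toSet _
    refine ⟨hfin.toFinset, hfin.coe_toFinset, ?_⟩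
    have h1 : ∑ P ∈ hfin.toFinset, q ^ sppNorm P =
        q ^ (∑ j, β j) * ∑ γ ∈ interlacing β, ∑ P ∈ T γ, q ^ sppNorm P := by
      rw [← sum_biUnion]
      · have h2 : (interlacing β).biUnion T = hfin.toFinset.image decrease := by
          rw [← coe_inj, ← himage]
          simp
        rw [h2, sum_image (by simpa using hinj), mul_sum]
        refine sum_congr rfl fun P hP => ?_
        rw [Set.Finite.mem_toFinset] at hP
        rw [P.sppNorm_eq_add hP.1, sum_rowLen_of_mem_ofShape hP, pow_add]
      · intro γ hγ γ' hγ' hne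
        refine disjoint_left.2 fun P hP hP' => hne ?_
        exact eq_of_mem_ofShape ((hmem γ hγ P).1 hP) ((hmem γ' hγ' P).1 hP')
    have h0 : interlacing (0 : Fin (n + 1) → ℕ) = {0} := by
      ext γ
      simp [interlacing, funext_iff]
    rw [h1, alternant_branching q hβ, alternant_branching q (β := 0) (fun _ _ _ => le_rfl), h0,
      sum_singleton]
    have h3 : ∑ γ ∈ interlacing β, alternant (fun i : Fin n => q ^ ((i : ℕ) + 1)) γ =
        (∑ γ ∈ interlacing β, ∑ P ∈ T γ, q ^ sppNorm P) *
          alternant (fun i : Fin n => q ^ ((i : ℕ) + 1)) 0 := by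
      rw [sum_mul]
      exact sum_congr rfl fun γ hγ => (hT γ (monotone_of_mem_interlacing hγ)).2.symm
    rw [h3]
    simp only [Pi.zero_apply, sum_const_zero, pow_zero]
    ring

end SPP

namespace SPP

lemma rowLen_antitone (P : SPP) : Antitone (rowLen P) :=
  antitone_nat_of_succ_le fun i => (P.rowLen_succ_le_rowLen_decrease i).trans
    (P.rowLen_decrease_le i)

lemma oddRows_eq_card (P : SPP) {n : ℕ} (hn : ∀ i j, P.part i j ≤ n) :
    oddRows P = (univ.filter fun i : Fin n => Odd (rowLen P (n - 1 - i))).card := by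
  have hinj : Function.Injective fun i : Fin n => n - 1 - (i : ℕ) := by
    intro i j h
    dsimp only at h
    ext
    omega
  have h1 : {i | Odd (rowLen P i)} = ((univ.filter fun i : Fin n =>
      Odd (rowLen P (n - 1 - i))).image fun i : Fin n => n - 1 - (i : ℕ) : Finset ℕ) := by
    ext i
    simp only [Set.mem_ofPred_eq, coe_image, coe_filter, mem_univ, true_and, Set.mem_image]
    constructor
    · intro h
      have hi : i < n := by
        by_contra hi
        rw [P.rowLen_eq_zero hn (not_lt.1 hi)] at h
        exact absurd h (by decide)
      refine ⟨⟨n - 1 - i, by omega⟩, ?_, ?_⟩ <;> dsimp only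
      · rwa [show n - 1 - (n - 1 - i) = i by omega]
      · omega
    · rintro ⟨j, h, rfl⟩
      exact h
  rw [oddRows, h1, Set.ncard_coe_finset, card_image_of_injective _ hinj]

/-- The strict plane partitions with parts at most `n`, at most `c` columns and exactly `p` rows
of odd length. -/
def bounded (n c p : ℕ) : Set SPP :=
  {P | (∀ i j, P.part i j ≤ n) ∧ (∀ i j, c ≤ j → P.part i j = 0) ∧ oddRows P = p}

lemma mem_bounded_iff {n c p : ℕ} {P : SPP} :
    P ∈ bounded n c p ↔ ∃ β ∈ boundedParts n c p, P ∈ ofShape β := by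
  have hc : (∀ i j, c ≤ j → P.part i j = 0) ↔ ∀ i, rowLen P i ≤ c := by
    refine forall_congr' fun i => ⟨fun h => ?_, fun h j hj => ?_⟩
    · have := P.part_ne_zero_iff i c
      have := h c le_rfl
      omega
    · have := P.part_ne_zero_iff i j
      have := h
      omega
  constructor
  · rintro ⟨h1, h2, h3⟩
    refine ⟨fun i => rowLen P (n - 1 - i), mem_boundedParts.2 ⟨fun j => hc.1 h2 _,
      fun i j h => P.rowLen_antitone ?_, ?_⟩, h1, fun i => rfl⟩
    · have : (i : ℕ) ≤ j := h
      omega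
    · rw [← h3, P.oddRows_eq_card h1]
  · rintro ⟨β, hβ, h1, h2⟩
    obtain ⟨h3, -, h4⟩ := mem_boundedParts.1 hβ
    refine ⟨h1, hc.2 fun i => ?_, ?_⟩
    · rcases lt_or_ge i n with h | h
      · have h5 := h2 ⟨n - 1 - i, by omega⟩
        have h6 := h3 ⟨n - 1 - i, by omega⟩
        rw [← h5] at h6
        dsimp only at h6
        rwa [show n - 1 - (n - 1 - i) = i by omega] at h6
      · rw [P.rowLen_eq_zero h1 h]
        exact Nat.zero_le c
    · rw [P.oddRows_eq_card h1, ← h4]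
      simp_rw [h2]

lemma alternant_rev {n : ℕ} (β : Fin n → ℕ) :
    alternant (fun i : Fin n => q ^ (n - (i : ℕ))) β =
      (Equiv.Perm.sign (Fin.revPerm : Equiv.Perm (Fin n)) : ℤ) *
        alternant (fun i : Fin n => q ^ ((i : ℕ) + 1)) β := by
  rw [alternant, alternant, ← Matrix.det_permute']
  congr 1
  ext j i
  simp only [Matrix.of_apply, Matrix.submatrix_apply, id_eq, Fin.revPerm_apply, Fin.val_rev]
  congr 2
  omega

theorem finite_bounded_and_sum_mul_alternant (n c p : ℕ) :
    ∃ hfin : (bounded n c p).Finite, (∑ P ∈ hfin.toFinset, q ^ sppNorm P) *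
      alternant (fun i : Fin n => q ^ (n - (i : ℕ))) 0 =
        altSum c p fun i : Fin n => q ^ (n - (i : ℕ)) := by
  classical
  have hT : ∀ β : Fin n → ℕ, ∃ T : Finset SPP, β ∈ boundedParts n c p → (T : Set SPP) = ofShape β ∧
      (∑ P ∈ T, q ^ sppNorm P) * alternant (fun i : Fin n => q ^ ((i : ℕ) + 1)) 0 =
        alternant (fun i : Fin n => q ^ ((i : ℕ) + 1)) β := by
    intro β
    by_cases h : Monotone β
    · obtain ⟨T, hT⟩ := exists_finset_ofShape n β h
      exact ⟨T, fun _ => hT⟩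
    · exact ⟨∅, fun h' => absurd (mem_boundedParts.1 h').2.1 h⟩
  choose T hT using hT
  have hmem : ∀ β ∈ boundedParts n c p, ∀ P, P ∈ T β ↔ P ∈ ofShape β := by
    intro β hβ P
    rw [← (hT β hβ).1, mem_coe]
  have hset : bounded n c p = ((boundedParts n c p).biUnion T : Finset SPP) := by
    ext P
    rw [mem_bounded_iff, mem_coe, mem_biUnion]
    exact exists_congr fun β => and_congr_right fun hβ => (hmem β hβ P).symm
  have hfin : (bounded n c p).Finite := by
    rw [hset]
    exact finite_toSet _
  have hfin' : hfin.toFinset = (boundedParts n c p).biUnion T := by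
    rw [← coe_inj, hfin.coe_toFinset, hset]
  refine ⟨hfin, ?_⟩
  rw [hfin', sum_biUnion, sum_mul, altSum]
  · refine sum_congr rfl fun β hβ => ?_
    rw [alternant_rev, alternant_rev, ← (hT β hβ).2]
    ring
  · intro β hβ γ hγ hne
    refine disjoint_left.2 fun P hP hP' => hne ?_
    exact eq_of_mem_ofShape ((hmem β hβ P).1 hP) ((hmem γ hγ P).1 hP')

end SPP

/-! ### Evaluation at geometric sequences -/

section GeometricSequence

variable {K : Type*} [CommRing K] (t : K)

/-- The product `(1 - t ^ a) * (1 - t ^ (a + 1)) * ⋯` of `n` factors. -/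
def qPoch (a n : ℕ) : K := ∏ i ∈ range n, (1 - t ^ (a + i))

/-- The sequence `t ^ (k + n - 1), …, t ^ (k + 1), t ^ k`. -/
def geomSeq (n k : ℕ) : Fin n → K := fun i => t ^ (k + (i.rev : ℕ))

lemma prod_fin_rev {M : Type*} [CommMonoid M] {n : ℕ} (f : ℕ → M) :
    ∏ i : Fin n, f (i.rev : ℕ) = ∏ i ∈ range n, f i := by
  rw [← Fin.prod_univ_eq_prod_range]
  exact Fintype.prod_equiv Fin.revPerm _ _ fun _ => rfl

lemma qPoch_succ (n : ℕ) : qPoch t 1 (n + 1) = qPoch t 1 n * (1 - t ^ (n + 1)) := by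
  rw [qPoch, prod_range_succ, add_comm 1 n, qPoch]

lemma pairProd_geomSeq_succAbove {n p : ℕ} (k : ℕ) (s : Fin (n + 1)) (hp : p + s = n) :
    pairProd (geomSeq t (n + 1) k) =
      qPoch t (2 * k + p) (n + 1) * pairProd fun j => geomSeq t (n + 1) k (s.succAbove j) := by
  rw [pairProd_succAbove _ s]
  congr 1
  rw [qPoch, ← prod_fin_rev]
  refine prod_congr rfl fun j _ => ?_
  rw [geomSeq, geomSeq, ← pow_add, Fin.val_rev s]
  congr 2
  omega

lemma geomSeq_castSucc (n k : ℕ) (j : Fin n) :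
    geomSeq t (n + 1) k j.castSucc = geomSeq t n (k + 1) j := by
  rw [geomSeq, geomSeq, Fin.val_rev, Fin.val_rev, Fin.val_castSucc]
  congr 1
  omega

lemma pairProd_geomSeq (n k : ℕ) :
    pairProd (geomSeq t n k) = ∏ i ∈ range n, qPoch t (2 * k + 2 * i) (n - i) := by
  induction n generalizing k with
  | zero => simp [pairProd]
  | succ n ih =>
    rw [pairProd_geomSeq_succAbove t k (Fin.last n) (zero_add _), prod_range_succ', mul_comm]
    congr 1
    simp_rw [Fin.succAbove_last, geomSeq_castSucc]
    rw [ih]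
    refine prod_congr rfl fun i _ => ?_
    congr 1 <;> omega

/-- Splitting the factors that involve the index `s` off a Vandermonde product. -/
lemma alternant_zero_succAbove {n : ℕ} (x : Fin (n + 1) → K) (s : Fin (n + 1)) :
    alternant x 0 =
      (∏ j, if j < s then x s - x j else if s < j then x j - x s else 1) *
        alternant (fun j => x (s.succAbove j)) 0 := by
  let g : Fin (n + 1) → Fin (n + 1) → K := fun i j =>
    if j < i then x i - x j else if i < j then x j - x i else 1
  have hg : ∀ i j, g i j = g j i := by
    intro i j
    dsimp only [g]
    rcases lt_trichotomy i j with h | rfl | h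
    · rw [if_neg h.not_gt, if_pos h, if_pos h]
    · rfl
    · rw [if_pos h, if_neg h.not_gt, if_pos h]
  have h1 := prod_pairs_succAbove g hg s
  simp_rw [prod_Ici_eq_prod_mul_prod_Ioi] at h1
  have h2 : ∀ i, g i i = 1 := fun i => by simp [g]
  simp_rw [h2, one_mul] at h1
  rw [alternant_zero, alternant_zero]
  refine Eq.trans ?_ (h1.trans ?_)
  · refine prod_congr rfl fun i _ => prod_congr rfl fun j hj => ?_
    have hij := mem_Ioi.1 hj
    simp only [g, if_neg hij.not_gt, if_pos hij]
  · congr 1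
    refine prod_congr rfl fun i _ => prod_congr rfl fun j hj => ?_
    have hij := Fin.succAbove_lt_succAbove_iff (p := s) |>.2 (mem_Ioi.1 hj)
    simp only [g, if_neg hij.not_gt, if_pos hij]

lemma prod_geomSeq (n k : ℕ) : ∏ i, geomSeq t n k i = t ^ (k * n + ∑ i ∈ range n, i) := by
  simp_rw [geomSeq]
  rw [prod_fin_rev fun i => t ^ (k + i), prod_pow_eq_pow_sum, sum_add_distrib]
  simp [mul_comm]

lemma prod_geomSeq_gaps {n p : ℕ} (k : ℕ) (s : Fin (n + 1)) (hp : p + s = n) :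
    (∏ j, if j < s then geomSeq t (n + 1) k s - geomSeq t (n + 1) k j
      else if s < j then geomSeq t (n + 1) k j - geomSeq t (n + 1) k s else 1) =
      t ^ (k * n + s * p + ∑ i ∈ range p, i) * (qPoch t 1 s * qPoch t 1 p) := by
  obtain ⟨s, hs⟩ := s
  dsimp only at hp ⊢
  simp_rw [geomSeq, Fin.lt_def, Fin.val_rev]
  rw [Fin.prod_univ_eq_prod_range (fun j => if j < s then
    t ^ (k + (n + 1 - (s + 1))) - t ^ (k + (n + 1 - (j + 1))) else if s < j then
    t ^ (k + (n + 1 - (j + 1))) - t ^ (k + (n + 1 - (s + 1))) else 1)]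
  have hn : n + 1 = s + 1 + p := by omega
  rw [hn, prod_range_add, prod_range_succ]
  have h1 : ∀ j ∈ range s, (if j < s then
      t ^ (k + (s + 1 + p - (s + 1))) - t ^ (k + (s + 1 + p - (j + 1))) else if s < j then
      t ^ (k + (s + 1 + p - (j + 1))) - t ^ (k + (s + 1 + p - (s + 1))) else 1) =
      t ^ (k + p) * (1 - t ^ (1 + (s - 1 - j))) := by
    intro j hj
    rw [mem_range] at hj
    rw [if_pos hj, mul_sub, mul_one, ← pow_add]
    congr 2 <;> omega
  have h2 : ∀ i ∈ range p, (if s + 1 + i < s then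
      t ^ (k + (s + 1 + p - (s + 1))) - t ^ (k + (s + 1 + p - (s + 1 + i + 1))) else
      if s < s + 1 + i then
      t ^ (k + (s + 1 + p - (s + 1 + i + 1))) - t ^ (k + (s + 1 + p - (s + 1))) else 1) =
      t ^ (k + (p - 1 - i)) * (1 - t ^ (1 + i)) := by
    intro i hi
    rw [mem_range] at hi
    rw [if_neg (by omega), if_pos (by omega), mul_sub, mul_one, ← pow_add]
    congr 2 <;> omega
  rw [prod_congr rfl h1, prod_congr rfl h2, prod_mul_distrib, prod_mul_distrib,
    prod_range_reflect (fun j => 1 - t ^ (1 + j)), prod_range_reflect (fun j => t ^ (k + j)),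
    prod_pow_eq_pow_sum, prod_pow_eq_pow_sum, sum_add_distrib (s := range p)]
  simp only [sum_const, card_range, lt_irrefl, if_false, smul_eq_mul, qPoch]
  rw [← hp]
  ring

lemma alternant_geomSeq_add (n k l : ℕ) : alternant (geomSeq t n (k + l)) 0 =
    t ^ (k * ∑ i ∈ range n, i) * alternant (geomSeq t n l) 0 := by
  have h : alternant (geomSeq t n (k + l)) 0 =
      (∏ j : Fin n, t ^ (k * (j : ℕ))) * alternant (geomSeq t n l) 0 := by
    rw [alternant, alternant, ← Matrix.det_mul_column]
    congr 1
    ext j i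
    simp only [Matrix.of_apply, geomSeq, Pi.zero_apply]
    ring
  rw [h, Fin.prod_univ_eq_prod_range (fun j => t ^ (k * j)), prod_pow_eq_pow_sum, mul_sum]

lemma altSum_zero_zero {n : ℕ} (x : Fin n → K) : altSum 0 0 x = alternant x 0 := by
  have h : boundedParts n 0 0 = {0} := by
    ext β
    rw [mem_boundedParts, mem_singleton]
    constructor
    · rintro ⟨h, -, -⟩
      exact funext fun j => Nat.le_zero.1 (h j)
    · rintro rfl
      exact ⟨fun _ => le_rfl, fun _ _ _ => le_rfl, by simp⟩
  rw [altSum, h, sum_singleton]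

lemma prod_pow_mul_sympDet_geomSeq (n k : ℕ) (s : Fin (n + 1)) :
    (∏ j, geomSeq t (n + 1) k (s.succAbove j)) ^ n * sympDet (geomSeq t n 1) k s =
      t ^ ((k + n) * ∑ i ∈ range (n + 1), i) *
        (alternant (fun j => geomSeq t (n + 1) k (s.succAbove j)) 0 *
          pairProd fun j => geomSeq t (n + 1) k (s.succAbove j)) := by
  set z : Fin n → K := fun j => geomSeq t (n + 1) k (s.succAbove j) with hz
  have h1 := altSum_even_mul_pairProd n 0 0 (Fin.last n) z (zero_add _)
  rw [mul_zero, altSum_zero_zero] at h1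
  have h2 : ∏ i : Fin n, t ^ ((k + n) * (1 + (i.rev : ℕ))) =
      t ^ ((k + n) * ∑ i ∈ range (n + 1), i) := by
    rw [prod_fin_rev fun i => t ^ ((k + n) * (1 + i)), prod_pow_eq_pow_sum, ← mul_sum,
      sum_range_succ']
    simp_rw [add_comm 1, add_zero]
  rw [h1, ← h2, sympDet, sympDet, ← prod_pow, ← Matrix.det_mul_column, ← Matrix.det_mul_column,
    ← Matrix.det_transpose]
  congr 1
  ext i j
  simp only [Matrix.transpose_apply, Matrix.of_apply, sympEntry, Fin.succAbove_last,
    Fin.val_castSucc, hz, geomSeq, Fin.val_rev]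
  have hj := (s.succAbove j).isLt
  generalize (s.succAbove j : ℕ) = e at hj ⊢
  obtain ⟨a, ha⟩ : ∃ a, n = a + 1 + i := ⟨n - 1 - i, by omega⟩
  obtain ⟨b, hb⟩ : ∃ b, n = e + b := ⟨n - e, by omega⟩
  rw [show 1 + (n - ((i : ℕ) + 1)) = a + 1 by omega, show n + 1 - (e + 1) = b by omega,
    show 2 * k + 2 * n - e = 2 * k + 2 * b + e by omega,
    show 2 * 0 + 2 * n - (i : ℕ) = 2 * (a + 1) + i by omega,
    show k + n = k + e + b by omega]
  rw [show (t ^ (k + b)) ^ n = (t ^ (k + b)) ^ (a + 1 + (i : ℕ)) by rw [← ha]]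
  ring

lemma sum_range_id_mul_two_add (n : ℕ) : (∑ i ∈ range n, i) * 2 + n = n * n := by
  rw [sum_range_id_mul_two]
  cases n with
  | zero => rfl
  | succ n => rw [Nat.add_sub_cancel]; ring

/-- The symplectic determinant at a geometric sequence. -/
theorem sympDet_geomSeq_mul [IsDomain K] (ht : t ≠ 0) {n p : ℕ} (k : ℕ) (s : Fin (n + 1))
    (hp : p + s = n) :
    sympDet (geomSeq t n 1) k s * (qPoch t 1 s * qPoch t 1 p) =
      t ^ (∑ i ∈ range (p + 1), i) * qPoch t 1 n * (alternant (geomSeq t n 1) 0 *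
        pairProd fun j => geomSeq t (n + 1) k (s.succAbove j)) := by
  have h1 := prod_pow_mul_sympDet_geomSeq t n k s
  have h2 := Fin.prod_univ_succAbove (geomSeq t (n + 1) k) s
  rw [prod_geomSeq] at h2
  have h3 := alternant_zero_succAbove (geomSeq t (n + 1) k) s
  rw [prod_geomSeq_gaps t k s hp, alternant_zero_succAbove _ (Fin.last n),
    prod_geomSeq_gaps t k (Fin.last n) (zero_add _)] at h3
  simp_rw [Fin.succAbove_last, geomSeq_castSucc] at h3
  change _ * alternant (geomSeq t n (k + 1)) 0 = _ at h3
  rw [alternant_geomSeq_add] at h3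
  have h4 : geomSeq t (n + 1) k s = t ^ (k + p) := by
    rw [geomSeq, Fin.val_rev]
    congr 1
    omega
  rw [h4] at h2
  have h5 : qPoch t 1 0 = 1 := by simp [qPoch]
  simp only [range_zero, sum_empty, Fin.val_last, mul_zero, add_zero, h5, mul_one] at h3
  have hpow : (k + p) * n + (k + n) * (∑ i ∈ range (n + 1), i) + k * n + k * ∑ i ∈ range n, i =
      (k * (n + 1) + ∑ i ∈ range (n + 1), i) * n + (k * n + s * p + ∑ i ∈ range p, i) +
        ∑ i ∈ range (p + 1), i := by
    have h6 := sum_range_id_mul_two_add n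
    have h7 := sum_range_id_mul_two_add p
    rw [sum_range_succ, sum_range_succ]
    zify at h6 h7 hp ⊢
    linear_combination k * h6 - h7 - p * hp
  refine mul_left_cancel₀ (pow_ne_zero ((k * (n + 1) + ∑ i ∈ range (n + 1), i) * n +
    (k * n + s * p + ∑ i ∈ range p, i)) ht) ?_
  generalize (∏ j, geomSeq t (n + 1) k (s.succAbove j)) = Z at *
  generalize alternant (fun j => geomSeq t (n + 1) k (s.succAbove j)) 0 = A at *
  generalize (pairProd fun j => geomSeq t (n + 1) k (s.succAbove j)) = Q at *
  generalize sympDet (geomSeq t n 1) k s = D at *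
  generalize alternant (geomSeq t n 1) 0 = B at *
  have hL : t ^ ((k * (n + 1) + ∑ i ∈ range (n + 1), i) * n +
      (k * n + s * p + ∑ i ∈ range p, i)) * (D * (qPoch t 1 s * qPoch t 1 p)) =
      (t ^ (k * (n + 1) + ∑ i ∈ range (n + 1), i)) ^ n * D *
        (t ^ (k * n + s * p + ∑ i ∈ range p, i) * (qPoch t 1 s * qPoch t 1 p)) := by
    ring
  have hR : t ^ ((k * (n + 1) + ∑ i ∈ range (n + 1), i) * n +
      (k * n + s * p + ∑ i ∈ range p, i)) *
      (t ^ (∑ i ∈ range (p + 1), i) * qPoch t 1 n * (B * Q)) =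
      (t ^ (k + p)) ^ n * t ^ ((k + n) * ∑ i ∈ range (n + 1), i) * Q *
        (t ^ (k * n) * qPoch t 1 n * (t ^ (k * ∑ i ∈ range n, i) * B)) := by
    have : t ^ ((k * (n + 1) + ∑ i ∈ range (n + 1), i) * n +
        (k * n + s * p + ∑ i ∈ range p, i)) * t ^ (∑ i ∈ range (p + 1), i) =
        (t ^ (k + p)) ^ n * t ^ ((k + n) * ∑ i ∈ range (n + 1), i) * t ^ (k * n) *
          t ^ (k * ∑ i ∈ range n, i) := by
      rw [← pow_add, ← hpow, ← pow_mul, ← pow_add, ← pow_add, ← pow_add]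
    linear_combination qPoch t 1 n * (B * Q) * this
  rw [hL, hR, h2, h3, mul_pow]
  linear_combination ((t ^ (k + p)) ^ n *
    (t ^ (k * n + s * p + ∑ i ∈ range p, i) * (qPoch t 1 s * qPoch t 1 p))) * h1

lemma elemSymm_zero {n : ℕ} (x : Fin n → K) : elemSymm 0 x = 1 := by
  simp [elemSymm]

lemma elemSymm_eq_zero {n p : ℕ} (hp : n < p) (x : Fin n → K) : elemSymm p x = 0 := by
  rw [elemSymm, powersetCard_eq_empty.2 (by simpa using hp), sum_empty]

lemma elemSymm_succ {n : ℕ} (p : ℕ) (x : Fin (n + 1) → K) :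
    elemSymm (p + 1) x =
      elemSymm (p + 1) (fun i => x (Fin.succ i)) + x 0 * elemSymm p fun i => x (Fin.succ i) := by
  simp_rw [elemSymm_eq_coeff]
  rw [Fin.prod_univ_succ, add_mul, one_mul, Polynomial.coeff_add, mul_assoc,
    Polynomial.coeff_C_mul, Polynomial.coeff_X_mul]

/-- The `q`-binomial theorem for elementary symmetric functions. -/
theorem elemSymm_geomSeq_mul (n : ℕ) : ∀ p d : ℕ, p + d = n → elemSymm p (geomSeq t n 1) *
    (qPoch t 1 d * qPoch t 1 p) = t ^ (∑ i ∈ range (p + 1), i) * qPoch t 1 n := by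
  induction n with
  | zero =>
    intro p d h
    obtain rfl : p = 0 := by omega
    obtain rfl : d = 0 := by omega
    simp [elemSymm_zero, qPoch]
  | succ n ih =>
    intro p d h
    obtain _ | p := p
    · obtain rfl : d = n + 1 := by omega
      simp [elemSymm_zero, qPoch]
    have h0 : geomSeq t (n + 1) 1 0 = t ^ (n + 1) := by
      rw [geomSeq, Fin.val_rev]
      congr 1
      simp
      omega
    have h1 : (fun i : Fin n => geomSeq t (n + 1) 1 i.succ) = geomSeq t n 1 := by
      ext i
      rw [geomSeq, geomSeq, Fin.val_rev, Fin.val_rev, Fin.val_succ]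
      congr 2
      omega
    have h2 : qPoch t 1 0 = 1 := by simp [qPoch]
    rw [elemSymm_succ, h0, h1, sum_range_succ, qPoch_succ, qPoch_succ]
    obtain _ | d := d
    · obtain rfl : p = n := by omega
      have h3 := ih p 0 rfl
      rw [elemSymm_eq_zero (Nat.lt_succ_self p)]
      linear_combination t ^ (p + 1) * (1 - t ^ (p + 1)) * h3
    · have h3 := ih (p + 1) d (by omega)
      have h4 := ih p (d + 1) (by omega)
      obtain rfl : n = p + 1 + d := by omega
      rw [sum_range_succ, qPoch_succ] at h3
      rw [qPoch_succ] at h4 ⊢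
      linear_combination (1 - t ^ (d + 1)) * h3 + t ^ (p + 1 + d + 1) * (1 - t ^ (p + 1)) * h4

end GeometricSequence

/-! ### Evaluation in the field of rational functions -/

lemma q_ne_zero : q ≠ 0 := RatFunc.X_ne_zero

lemma one_sub_q_pow_ne_zero {m : ℕ} (hm : m ≠ 0) : 1 - q ^ m ≠ 0 := by
  intro h
  have h1 : algebraMap (Polynomial ℚ) (RatFunc ℚ) (Polynomial.X ^ m) =
      algebraMap (Polynomial ℚ) (RatFunc ℚ) 1 := by
    rw [map_pow, map_one, RatFunc.algebraMap_X]
    exact (sub_eq_zero.1 h).symm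
  have h2 := congrArg Polynomial.natDegree (RatFunc.algebraMap_injective ℚ h1)
  rw [Polynomial.natDegree_X_pow, Polynomial.natDegree_one] at h2
  exact hm h2

lemma qPoch_ne_zero {a : ℕ} (ha : a ≠ 0) (n : ℕ) : qPoch q a n ≠ 0 :=
  prod_ne_zero_iff.2 fun _ _ => one_sub_q_pow_ne_zero (by omega)

lemma one_sub_q_ne_zero : 1 - q ≠ 0 := by
  simpa using one_sub_q_pow_ne_zero one_ne_zero

lemma qfac_natCast (a n : ℕ) : qfac a n = qPoch q a n / (1 - q) ^ n := by
  have h : (1 - q) ^ n = ∏ _i ∈ range n, (1 - q) := by simp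
  rw [qfac, qPoch, h, ← prod_div_distrib]
  refine prod_congr rfl fun i _ => ?_
  rw [qb, ← Nat.cast_add, zpow_natCast]

lemma binq_mul {n p s : ℕ} (hp : p + s = n) :
    binq n p * (qPoch q 1 s * qPoch q 1 p) = qPoch q 1 n := by
  have h1 := qPoch_ne_zero one_ne_zero p
  have h2 := pow_ne_zero p one_sub_q_ne_zero
  have h3 : qPoch q 1 n = qPoch q 1 s * qPoch q (s + 1) p := by
    rw [← hp, add_comm p s, qPoch, prod_range_add, qPoch, qPoch]
    congr 1
    refine prod_congr rfl fun i _ => ?_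
    congr 2
    omega
  have h4 : (n : ℤ) - p + 1 = (s + 1 : ℕ) := by
    push_cast
    omega
  have h5 := qfac_natCast 1 p
  rw [Nat.cast_one] at h5
  rw [binq, if_pos (by omega), h4, Int.toNat_natCast, qfac_natCast, h5, h3]
  field_simp

lemma alternant_geomSeq_ne_zero (n : ℕ) : alternant (geomSeq q n 1) 0 ≠ 0 := by
  rw [alternant_zero]
  refine prod_ne_zero_iff.2 fun i _ => prod_ne_zero_iff.2 fun j hj => ?_
  have hij : i < j := mem_Ioi.1 hj
  rw [Fin.lt_def] at hij
  have h : geomSeq q n 1 j - geomSeq q n 1 i =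
      q ^ (1 + (j.rev : ℕ)) * (1 - q ^ ((j : ℕ) - i)) := by
    rw [geomSeq, geomSeq, mul_sub, mul_one, ← pow_add, Fin.val_rev, Fin.val_rev]
    congr 2
    omega
  rw [h]
  exact mul_ne_zero (pow_ne_zero _ q_ne_zero) (one_sub_q_pow_ne_zero (by omega))

lemma pairProd_geomSeq_ne_zero (n : ℕ) : pairProd (geomSeq q n 1) ≠ 0 := by
  rw [pairProd_geomSeq]
  exact prod_ne_zero_iff.2 fun i _ => qPoch_ne_zero (by omega) _

lemma sum_range_succ_id (p : ℕ) : ∑ i ∈ range (p + 1), i = p * (p + 1) / 2 := by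
  rw [sum_range_id, Nat.add_sub_cancel, mul_comm]

lemma elemSymm_geomSeq {n p : ℕ} (hp : p ≤ n) :
    elemSymm p (geomSeq q n 1) = q ^ (p * (p + 1) / 2) * binq n p := by
  obtain ⟨s, rfl⟩ := Nat.exists_eq_add_of_le hp
  have h1 := elemSymm_geomSeq_mul q (p + s) p s rfl
  have h2 := binq_mul (rfl : p + s = p + s)
  have h3 := mul_ne_zero (qPoch_ne_zero one_ne_zero s) (qPoch_ne_zero one_ne_zero p)
  refine mul_right_cancel₀ h3 ?_
  rw [h1, sum_range_succ_id, mul_assoc, h2]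

lemma altSum_even_geomSeq {n p : ℕ} (k : ℕ) (s : Fin (n + 1)) (hp : p + s = n) :
    altSum (2 * k) p (geomSeq q n 1) * pairProd (geomSeq q n 1) =
      q ^ (p * (p + 1) / 2) * binq n p * (alternant (geomSeq q n 1) 0 *
        pairProd fun j => geomSeq q (n + 1) k (s.succAbove j)) := by
  have h1 := sympDet_geomSeq_mul q q_ne_zero k s hp
  have h2 := binq_mul hp
  have h3 := mul_ne_zero (qPoch_ne_zero one_ne_zero s) (qPoch_ne_zero one_ne_zero p)
  rw [altSum_even_mul_pairProd n k p s _ hp]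
  refine mul_right_cancel₀ h3 ?_
  rw [h1, sum_range_succ_id, ← h2]
  ring

theorem SPP.sum_even {n p : ℕ} {k : ℕ} (hp : p ≤ n) (h0 : 2 * k + p ≠ 0) {F : RatFunc ℚ}
    (hF : F * alternant (geomSeq q n 1) 0 = altSum (2 * k) p (geomSeq q n 1)) :
    F = q ^ (p * (p + 1) / 2) * binq n p * (1 / qfac (2 * k + p : ℕ) (n + 1)) *
      ∏ i ∈ range (n + 1), qfac (2 * k + 2 * i : ℕ) (n - i + 1) / qfac (2 + 2 * i : ℕ) (n - i) := by
  have h1 := altSum_even_geomSeq k ⟨n - p, by omega⟩ (show p + (n - p) = n by omega)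
  have h2 := pairProd_geomSeq_succAbove q k ⟨n - p, by omega⟩ (show p + (n - p) = n by omega)
  rw [← hF] at h1
  have h3 := qPoch_ne_zero h0 (n + 1)
  have h4 := one_sub_q_ne_zero
  have h5 := pairProd_geomSeq_ne_zero n
  have h6 : ∏ i ∈ range (n + 1),
      qfac (2 * k + 2 * i : ℕ) (n - i + 1) / qfac (2 + 2 * i : ℕ) (n - i) =
      pairProd (geomSeq q (n + 1) k) / pairProd (geomSeq q n 1) / (1 - q) ^ (n + 1) := by
    have h7 : pairProd (geomSeq q n 1) = ∏ i ∈ range (n + 1), qPoch q (2 + 2 * i) (n - i) := by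
      rw [pairProd_geomSeq, prod_range_succ _ n]
      simp [qPoch]
    have h8 : (1 - q) ^ (n + 1) = ∏ i ∈ range (n + 1), (1 - q) := by simp
    rw [h7, pairProd_geomSeq, h8, ← prod_div_distrib, ← prod_div_distrib]
    refine prod_congr rfl fun i hi => ?_
    have hi' : n + 1 - i = n - i + 1 := by
      rw [mem_range] at hi
      omega
    have h9 := qPoch_ne_zero (show 2 + 2 * i ≠ 0 by omega) (n - i)
    rw [qfac_natCast, qfac_natCast, hi', pow_succ]
    field_simp
  rw [h6, h2, qfac_natCast]
  refine mul_right_cancel₀ (mul_ne_zero (alternant_geomSeq_ne_zero n) h5) ?_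
  rw [← mul_assoc, h1]
  field_simp

theorem SPP.sum_odd {n p : ℕ} {k : ℕ} (hp : p ≤ n) {F : RatFunc ℚ}
    (hF : F * alternant (geomSeq q n 1) 0 = altSum (2 * k + 1) p (geomSeq q n 1)) :
    F = q ^ (p * (p + 1) / 2) * binq n p *
      ∏ i ∈ Icc 1 n, qfac (2 * k + 2 * i : ℕ) (n - i + 1) / qfac (2 * i : ℕ) (n - i + 1) := by
  have h1 := altSum_even_geomSeq (n := n) (p := 0) k (Fin.last n) (zero_add _)
  have h2 : binq n (0 : ℕ) = 1 := by
    have := binq_mul (zero_add n)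
    have h3 := qPoch_ne_zero one_ne_zero n
    refine mul_right_cancel₀ h3 ?_
    rw [one_mul]
    simpa [qPoch] using this
  have h5 := pairProd_geomSeq_ne_zero n
  simp_rw [Fin.succAbove_last, geomSeq_castSucc] at h1
  change _ = _ * (_ * pairProd (geomSeq q n (k + 1))) at h1
  rw [h2, zero_mul, Nat.zero_div, pow_zero, one_mul, one_mul] at h1
  rw [altSum_odd, elemSymm_geomSeq hp] at hF
  have h6 : ∏ i ∈ Icc 1 n, qfac (2 * k + 2 * i : ℕ) (n - i + 1) / qfac (2 * i : ℕ) (n - i + 1) =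
      pairProd (geomSeq q n (k + 1)) / pairProd (geomSeq q n 1) := by
    have h7 : Icc 1 n = Ico 1 (n + 1) := by
      ext
      simp only [mem_Icc, mem_Ico]
      omega
    rw [pairProd_geomSeq, pairProd_geomSeq, ← prod_div_distrib, h7, prod_Ico_eq_prod_range,
      Nat.add_sub_cancel]
    refine prod_congr rfl fun i hi => ?_
    rw [mem_range] at hi
    rw [qfac_natCast, qfac_natCast, div_div_div_cancel_right₀ (pow_ne_zero _ one_sub_q_ne_zero),
      show n - (1 + i) + 1 = n - i by omega, show 2 * (k + 1) + 2 * i = 2 * k + 2 * (1 + i) by ring,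
      show 2 * 1 + 2 * i = 2 * (1 + i) by ring]
  rw [h6]
  refine mul_right_cancel₀ (mul_ne_zero (alternant_geomSeq_ne_zero n) h5) ?_
  rw [← mul_assoc, hF, mul_assoc, h1]
  field_simp

/-- **Krattenthaler's refinement of the Bender–Knuth (ex-)Conjecture.** -/
theorem statement1 (n c p : ℕ) (hn : 1 ≤ n) (hp : p ≤ n) (h0 : ¬(c = 0 ∧ p = 0)) :
    ∃ hfin : {P : SPP | (∀ i j, P.part i j ≤ n) ∧ (∀ i j, c ≤ j → P.part i j = 0) ∧
        oddRows P = p}.Finite,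
      ∑ P ∈ hfin.toFinset, q ^ sppNorm P =
        if Even c then
          q ^ (p * (p + 1) / 2) * binq n p * (1 / qfac (c + p) (n + 1)) *
            ∏ i ∈ Finset.range (n + 1),
              qfac (c + 2 * i) (n - i + 1) / qfac (2 + 2 * i) (n - i)
        else
          q ^ (p * (p + 1) / 2) * binq n p *
            ∏ i ∈ Finset.Icc 1 n,
              qfac (c + 2 * i - 1) (n - i + 1) / qfac (2 * i) (n - i + 1) := by
  obtain ⟨hfin, hF⟩ := SPP.finite_bounded_and_sum_mul_alternant n c p
  have hx : (fun i : Fin n => q ^ (n - (i : ℕ))) = geomSeq q n 1 := by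
    ext i
    rw [geomSeq, Fin.val_rev]
    congr 1
    omega
  rw [hx] at hF
  refine ⟨hfin, ?_⟩
  rcases Nat.even_or_odd' c with ⟨k, rfl | rfl⟩
  · rw [if_pos (even_two_mul k)]
    refine (SPP.sum_even hp (by omega) hF).trans ?_
    push_cast
    rfl
  · rw [if_neg (Nat.not_even_two_mul_add_one k)]
    refine (SPP.sum_odd hp hF).trans ?_
    congr 1
    refine prod_congr rfl fun i _ => ?_
    congr 2
    push_cast
    ring
end

section
/- Let n ≥ 1, c ≥ 0 and 0 ≤ k ≤ c be integers. There exists a bijection between the set of (n−1,n,c)-patterns (a_{i,j}) satisfying 0 ≤ a_{n,n} ≤ c and a_{n,n} = k, and the set of strict plane partitions with parts in {1,…,n}, at most c columns and exactly k parts equal to n, such that the norm of each pattern equals the norm of the corresponding strict plane partition, and such that the sequence (a_{1,n}, a_{1,n−1}, …, a_{1,1}) is the shape of the corresponding strict plane partition. -/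
open Finset

/-- A generalized `(r,n,c)` Gelfand-Tsetlin pattern, encoded as `a : ℕ → ℕ → ℤ` with
rows `i = 1,…,r+1`, entries `a i j` for `i-1 ≤ j ≤ n+1`, and `a i j = 0` outside this
trapezoidal domain (a harmless normalization). -/
def IsPattern (r n c : ℕ) (a : ℕ → ℕ → ℤ) : Prop :=
  (∀ i, 1 ≤ i → i ≤ r + 1 → a i (i - 1) = 0 ∧ a i (n + 1) = c) ∧
  (∀ i j, 2 ≤ i → i ≤ r + 1 → i ≤ j + 1 → j ≤ n →
    ((a i j ≤ a i (j + 1) → a i j ≤ a (i - 1) j ∧ a (i - 1) j ≤ a i (j + 1)) ∧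
     (a i (j + 1) < a i j → a i (j + 1) < a (i - 1) j ∧ a (i - 1) j < a i j))) ∧
  (∀ i j, i = 0 ∨ r + 1 < i ∨ j + 1 < i ∨ n + 1 < j → a i j = 0)

/-- The norm of a pattern: the sum of all entries, omitting the first and last entry
of each row. -/
def patNorm (r n : ℕ) (a : ℕ → ℕ → ℤ) : ℤ :=
  ∑ i ∈ Finset.Icc 1 (r + 1), ∑ j ∈ Finset.Icc i n, a i j

/-- The number of inversions: pairs `(a i j, a i (j+1))` with `a i j > a i (j+1)`, `i ≠ 1`. -/
noncomputable def invCount (r n : ℕ) (a : ℕ → ℕ → ℤ) : ℕ :=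
  {ij : ℕ × ℕ | 2 ≤ ij.1 ∧ ij.1 ≤ r + 1 ∧ ij.1 ≤ ij.2 + 1 ∧ ij.2 ≤ n ∧
    a ij.1 (ij.2 + 1) < a ij.1 ij.2}.ncard

/-- The sign of a pattern. -/
noncomputable def patSign (r n : ℕ) (a : ℕ → ℕ → ℤ) : RatFunc ℚ := (-1) ^ invCount r n a

/-- The number of odd entries among `a 1 1, …, a 1 n`. -/
noncomputable def oddTop (n : ℕ) (a : ℕ → ℕ → ℤ) : ℕ :=
  {j | 1 ≤ j ∧ j ≤ n ∧ Odd (a 1 j)}.ncard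

/-- `Fq n c p k` is `F_q(n-1,n,c,p;k)`: the signed generating function of
`(n-1,n,c)`-patterns with `a n n = k` and exactly `p` odd entries in the bottom row,
divided by `q^k`. -/
noncomputable def Fq (n c p : ℕ) (k : ℤ) : RatFunc ℚ :=
  (∑ᶠ a ∈ {a : ℕ → ℕ → ℤ | IsPattern (n - 1) n c a ∧ a n n = k ∧ oddTop n a = p},
    patSign (n - 1) n a * q ^ patNorm (n - 1) n a) / q ^ k

lemma SPP.eq_of_part_eq {P Q : SPP} (h : ∀ i j, P.part i j = Q.part i j) : P = Q := by
  cases P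
  cases Q
  congr
  funext i j
  exact h i j

lemma le_card_filter_Icc_iff {N i : ℕ} {p : ℕ → Prop} [DecidablePred p]
    (hp : ∀ i j, 1 ≤ i → i ≤ j → j ≤ N → p j → p i) (hi : 1 ≤ i) (hiN : i ≤ N) :
    i ≤ #{x ∈ Icc 1 N | p x} ↔ p i := by
  constructor
  · intro h
    by_contra hpi
    have hsub : {x ∈ Icc 1 N | p x} ⊆ Icc 1 (i - 1) := by
      intro x hx
      rw [mem_filter, mem_Icc] at hx
      rw [mem_Icc]
      by_contra hlt
      exact hpi (hp i x hi (by omega) hx.1.2 hx.2)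
    have := card_le_card hsub
    rw [Nat.card_Icc] at this
    omega
  · intro h
    have hsub : Icc 1 i ⊆ {x ∈ Icc 1 N | p x} := by
      intro x hx
      rw [mem_Icc] at hx
      rw [mem_filter, mem_Icc]
      exact ⟨⟨hx.1, hx.2.trans hiN⟩, hp x i hx.1 hx.2 hiN h⟩
    simpa using card_le_card hsub

lemma lt_card_filter_range_iff {N x : ℕ} {p : ℕ → Prop} [DecidablePred p]
    (hp : ∀ i j, i ≤ j → p j → p i) (hx : x < N) :
    x < #{y ∈ range N | p y} ↔ p x := by
  constructor
  · intro h
    by_contra hpx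
    have hsub : {y ∈ range N | p y} ⊆ range x := by
      intro y hy
      rw [mem_filter] at hy
      rw [mem_range]
      by_contra hlt
      exact hpx (hp x y (by omega) hy.2)
    have := card_le_card hsub
    rw [card_range] at this
    omega
  · intro h
    have hsub : range (x + 1) ⊆ {y ∈ range N | p y} := by
      intro y hy
      rw [mem_range] at hy
      rw [mem_filter, mem_range]
      exact ⟨by omega, hp y x (by omega) h⟩
    simpa using card_le_card hsub

lemma SPP.part_le_sub {P : SPP} {n : ℕ} (hP : ∀ i j, P.part i j ≤ n) (i j : ℕ) :
    P.part i j ≤ n - i := by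
  induction i with
  | zero => simpa using hP 0 j
  | succ i ih =>
    by_cases h : P.part (i + 1) j = 0
    · omega
    · have := P.col_strict i j h
      omega

section OfPattern

variable {n c k : ℕ} {a : ℕ → ℕ → ℤ}

lemma IsPattern.row_step (ha : IsPattern (n - 1) n c a) (hk : k ≤ c)
    (hak : a n n = k) {i j : ℕ} (hi : 1 ≤ i) (hin : i ≤ n) (hij : i ≤ j + 1) (hj : j ≤ n) :
    a i j ≤ a i (j + 1) := by
  obtain ⟨hends, hint, -⟩ := ha
  induction hin using Nat.decreasingInduction generalizing j with
  | self =>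
    have h := hends n hi (by omega)
    rcases (show j = n - 1 ∨ j = n by omega) with rfl | rfl
    · rw [h.1, show n - 1 + 1 = n by omega, hak]
      positivity
    · rw [h.2, hak]
      exact_mod_cast hk
  | of_succ i hin ih =>
    have h := hends i hi (by omega)
    have h' := hends (i + 1) (by omega) (by omega)
    have hnext : ∀ j, i ≤ j → j ≤ n → a (i + 1) j ≤ a i j ∧ a i j ≤ a (i + 1) (j + 1) :=
      fun j hij hj => (hint (i + 1) j (by omega) (by omega) (by omega) hj).1
        (ih (by omega) (by omega) hj)
    rw [Nat.add_sub_cancel] at h'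
    rcases (show j = i - 1 ∨ j = n ∨ (i ≤ j ∧ j + 1 ≤ n) by omega) with rfl | rfl | ⟨h1, h2⟩
    · have := (hnext i le_rfl (by omega)).1
      rw [h.1, show i - 1 + 1 = i by omega]
      omega
    · have := (hnext j (by omega) le_rfl).2
      omega
    · exact (hnext j h1 (by omega)).2.trans (hnext (j + 1) (by omega) h2).1

lemma IsPattern.interlace (ha : IsPattern (n - 1) n c a) (hk : k ≤ c)
    (hak : a n n = k) {i j : ℕ} (hi : 1 ≤ i) (hin : i + 1 ≤ n) (hij : i ≤ j) (hj : j ≤ n) :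
    a (i + 1) j ≤ a i j ∧ a i j ≤ a (i + 1) (j + 1) :=
  (ha.2.1 (i + 1) j (by omega) (by omega) (by omega) hj).1
    (ha.row_step hk hak (by omega) hin (by omega) hj)

lemma IsPattern.nonneg (ha : IsPattern (n - 1) n c a) (hk : k ≤ c)
    (hak : a n n = k) {i j : ℕ} (hi : 1 ≤ i) (hin : i ≤ n) (hij : i - 1 ≤ j) (hj : j ≤ n + 1) :
    0 ≤ a i j := by
  induction j, hij using Nat.le_induction with
  | base => exact (ha.1 i hi (by omega)).1.ge
  | succ j hij ih =>
    exact (ih (by omega)).trans (ha.row_step hk hak hi hin (by omega) (by omega))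

lemma IsPattern.le_bound (ha : IsPattern (n - 1) n c a) (hk : k ≤ c)
    (hak : a n n = k) {i j : ℕ} (hi : 1 ≤ i) (hin : i ≤ n) (hij : i - 1 ≤ j) (hj : j ≤ n + 1) :
    a i j ≤ c := by
  induction hj using Nat.decreasingInduction with
  | self => exact (ha.1 i hi (by omega)).2.le
  | of_succ j hj ih =>
    exact (ha.row_step hk hak hi hin (by omega) (by omega)).trans (ih (by omega))

lemma IsPattern.anti (ha : IsPattern (n - 1) n c a) (hk : k ≤ c)
    (hak : a n n = k) {i i' j : ℕ} (hi : 1 ≤ i) (hii : i ≤ i') (hij : i' ≤ j) (hj : j ≤ n) :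
    a i' j ≤ a i j := by
  induction i', hii using Nat.le_induction with
  | base => exact le_rfl
  | succ i' hii ih =>
    exact (ha.interlace hk hak (by omega) (by omega) (by omega) hj).1.trans (ih (by omega))

/-- The part in row `m` and column `s` of the plane partition attached to a pattern: the number
of pattern rows `i` whose partition `(a i n, a i (n - 1), …)` contains the cell `(m, s)`. -/
def patternPart (n : ℕ) (a : ℕ → ℕ → ℤ) (m s : ℕ) : ℕ :=
  #{i ∈ Icc 1 (n - m) | (s : ℤ) < a i (n - m)}

lemma patternPart_le (m s : ℕ) : patternPart n a m s ≤ n - m :=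
  (card_filter_le _ _).trans (by simp)

lemma IsPattern.le_patternPart_iff (ha : IsPattern (n - 1) n c a) (hk : k ≤ c)
    (hak : a n n = k) {i m s : ℕ} (hi : 1 ≤ i) (him : i ≤ n - m) :
    i ≤ patternPart n a m s ↔ (s : ℤ) < a i (n - m) :=
  le_card_filter_Icc_iff (p := fun i => (s : ℤ) < a i (n - m))
    (fun _ _ h1 h2 h3 h4 => h4.trans_le (ha.anti hk hak h1 h2 h3 (by omega))) hi him

lemma IsPattern.patternPart_eq_zero (ha : IsPattern (n - 1) n c a) (hk : k ≤ c)
    (hak : a n n = k) {m s : ℕ} (hs : c ≤ s) : patternPart n a m s = 0 := by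
  rw [patternPart, card_eq_zero, filter_eq_empty_iff]
  intro i hi
  rw [mem_Icc] at hi
  have := ha.le_bound hk hak hi.1 (by omega) (j := n - m) (by omega) (by omega)
  omega

/-- The strict plane partition attached to a pattern. -/
def IsPattern.toSPP (ha : IsPattern (n - 1) n c a) (hk : k ≤ c) (hak : a n n = k) : SPP where
  part := patternPart n a
  supp_finite := by
    refine ((range n ×ˢ range c).finite_toSet).subset fun x hx => ?_
    rw [Set.mem_ofPred_eq] at hx
    rw [mem_coe, mem_product, mem_range, mem_range]
    refine ⟨?_, ?_⟩
    · have := patternPart_le (n := n) (a := a) x.1 x.2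
      omega
    · by_contra h
      exact hx (ha.patternPart_eq_zero hk hak (by omega))
  row_decr m s t hst := by
    refine card_le_card (monotone_filter_right _ fun i _ hi => ?_)
    exact lt_of_le_of_lt (by exact_mod_cast hst) hi
  col_strict m s h := by
    have hle := patternPart_le (n := n) (a := a) (m + 1) s
    set t := patternPart n a (m + 1) s with ht
    have h1 := (ha.le_patternPart_iff hk hak (by omega) hle).1 ht.le
    have h2 := (ha.interlace hk hak (i := t) (j := n - (m + 1))
      (by omega) (by omega) (by omega) (by omega)).2
    rw [show n - (m + 1) + 1 = n - m by omega] at h2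
    exact (ha.le_patternPart_iff hk hak (by omega) (by omega)).2 (h1.trans_le h2)

lemma ncard_setOf_cast_lt {x : ℤ} (hx : 0 ≤ x) : ({s : ℕ | (s : ℤ) < x}.ncard : ℤ) = x := by
  lift x to ℕ using hx
  have : {s : ℕ | (s : ℤ) < x} = (range x : Set ℕ) := by
    ext s
    simp
  rw [this, Set.ncard_coe_finset, card_range]

lemma IsPattern.rowLen_toSPP (ha : IsPattern (n - 1) n c a) (hk : k ≤ c) (hak : a n n = k)
    {m : ℕ} (hm : m < n) : (rowLen (ha.toSPP hk hak) m : ℤ) = a 1 (n - m) := by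
  have : {s | (ha.toSPP hk hak).part m s ≠ 0} = {s : ℕ | (s : ℤ) < a 1 (n - m)} := by
    ext s
    exact Nat.one_le_iff_ne_zero.symm.trans (ha.le_patternPart_iff hk hak le_rfl (by omega))
  rw [rowLen, this]
  exact ncard_setOf_cast_lt (ha.nonneg hk hak le_rfl (by omega) (by omega) (by omega))

lemma IsPattern.rowLen_toSPP_eq_zero (ha : IsPattern (n - 1) n c a) (hk : k ≤ c)
    (hak : a n n = k) {m : ℕ} (hm : n ≤ m) : rowLen (ha.toSPP hk hak) m = 0 := by
  have : {s | (ha.toSPP hk hak).part m s ≠ 0} = ∅ := by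
    ext s
    have : patternPart n a m s = 0 := by
      have := patternPart_le (n := n) (a := a) m s
      omega
    simp [IsPattern.toSPP, this]
  rw [rowLen, this, Set.ncard_empty]

lemma SPP.eqCount_eq {P : SPP} (hn : 1 ≤ n) (hP : ∀ i j, P.part i j ≤ n) :
    eqCount P n = {s | n ≤ P.part 0 s}.ncard := by
  have : {x : ℕ × ℕ | P.part x.1 x.2 = n} = (fun s => (0, s)) '' {s | n ≤ P.part 0 s} := by
    ext ⟨m, s⟩
    simp only [Set.mem_ofPred_eq, Set.mem_image, Prod.mk.injEq, exists_eq_right_right]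
    constructor
    · intro h
      have := P.part_le_sub hP m s
      obtain rfl : m = 0 := by omega
      exact ⟨h.ge, rfl⟩
    · rintro ⟨h, rfl⟩
      exact le_antisymm (hP 0 s) h
  rw [eqCount, this, Set.ncard_image_of_injective _ (Prod.mk_right_injective 0)]

lemma IsPattern.eqCount_toSPP (ha : IsPattern (n - 1) n c a) (hk : k ≤ c) (hak : a n n = k)
    (hn : 1 ≤ n) : eqCount (ha.toSPP hk hak) n = k := by
  rw [SPP.eqCount_eq hn fun m s => (patternPart_le m s).trans (Nat.sub_le n m)]
  have : {s | n ≤ (ha.toSPP hk hak).part 0 s} = {s : ℕ | (s : ℤ) < k} := by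
    ext s
    rw [← hak]
    exact ha.le_patternPart_iff hk hak (m := 0) hn le_rfl
  rw [this]
  exact_mod_cast ncard_setOf_cast_lt (x := k) (by positivity)

lemma IsPattern.card_filter_range (ha : IsPattern (n - 1) n c a) (hk : k ≤ c) (hak : a n n = k)
    {i j : ℕ} (hi : 1 ≤ i) (hij : i ≤ j) (hj : j ≤ n) :
    (#{s ∈ range c | ((s : ℕ) : ℤ) < a i j} : ℤ) = a i j := by
  have h0 := ha.nonneg hk hak hi (by omega) (j := j) (by omega) (by omega)
  have h1 := ha.le_bound hk hak hi (by omega) (j := j) (by omega) (by omega)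
  conv_rhs => rw [← ncard_setOf_cast_lt h0]
  rw [← Set.ncard_coe_finset]
  congr 2
  ext s
  simp only [coe_filter, mem_range, Set.mem_ofPred_eq]
  omega

lemma IsPattern.sppNorm_toSPP (ha : IsPattern (n - 1) n c a) (hk : k ≤ c) (hak : a n n = k)
    (hn : 1 ≤ n) : (sppNorm (ha.toSPP hk hak) : ℤ) = patNorm (n - 1) n a := by
  have hsupp : (Function.support fun x : ℕ × ℕ => (ha.toSPP hk hak).part x.1 x.2) ⊆
      (range n ×ˢ range c : Finset (ℕ × ℕ)) := by
    intro x hx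
    rw [Function.mem_support] at hx
    rw [mem_coe, mem_product, mem_range, mem_range]
    refine ⟨?_, ?_⟩
    · have : patternPart n a x.1 x.2 ≤ n - x.1 := patternPart_le x.1 x.2
      change patternPart n a x.1 x.2 ≠ 0 at hx
      omega
    · by_contra h
      exact hx (ha.patternPart_eq_zero hk hak (by omega))
  rw [sppNorm, finsum_eq_sum_of_support_subset _ hsupp, sum_product]
  push_cast
  have hrow : ∀ m ∈ range n, ∑ s ∈ range c, ((ha.toSPP hk hak).part m s : ℤ) =
      ∑ i ∈ Icc 1 (n - m), a i (n - m) := by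
    intro m _
    simp only [IsPattern.toSPP, patternPart, card_filter]
    push_cast
    rw [sum_comm]
    refine sum_congr rfl fun i hi => ?_
    rw [mem_Icc] at hi
    have h := ha.card_filter_range hk hak hi.1 hi.2 (by omega)
    rw [card_filter] at h
    exact_mod_cast h
  rw [sum_congr rfl hrow, patNorm, show n - 1 + 1 = n by omega]
  have hflip : ∑ m ∈ range n, ∑ i ∈ Icc 1 (n - m), a i (n - m) =
      ∑ j ∈ Icc 1 n, ∑ i ∈ Icc 1 j, a i j := by
    refine sum_nbij' (fun m => n - m) (fun j => n - j) ?_ ?_ ?_ ?_ (fun _ _ => rfl) <;>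
      simp only [mem_range, mem_Icc] <;> omega
  rw [hflip]
  refine sum_comm' fun j i => ?_
  simp only [mem_Icc]
  omega

end OfPattern

section OfSPP

variable {n c : ℕ} {P : SPP}

/-- The pattern attached to a strict plane partition: row `i` records the shape formed by the
parts that are at least `i`. -/
def SPP.toPattern (P : SPP) (n c i j : ℕ) : ℤ :=
  if 1 ≤ i ∧ i ≤ j ∧ j ≤ n then (#{s ∈ range c | i ≤ P.part (n - j) s} : ℤ)
  else if 1 ≤ i ∧ i ≤ n ∧ j = n + 1 then (c : ℤ) else 0

lemma SPP.toPattern_of_le {i j : ℕ} (hi : 1 ≤ i) (hij : i ≤ j) (hj : j ≤ n) :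
    P.toPattern n c i j = #{s ∈ range c | i ≤ P.part (n - j) s} :=
  if_pos ⟨hi, hij, hj⟩

lemma SPP.toPattern_last {i : ℕ} (hi : 1 ≤ i) (hin : i ≤ n) :
    P.toPattern n c i (n + 1) = c := by
  rw [toPattern, if_neg (by omega), if_pos ⟨hi, hin, rfl⟩]

lemma SPP.toPattern_eq_zero {i j : ℕ} (h : i = 0 ∨ n < i ∨ j < i ∨ n + 1 < j) :
    P.toPattern n c i j = 0 := by
  rw [toPattern, if_neg (by omega)]
  by_cases h' : 1 ≤ i ∧ i ≤ n ∧ j = n + 1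
  · omega
  · exact if_neg h'

lemma SPP.toPattern_nonneg (i j : ℕ) : 0 ≤ P.toPattern n c i j := by
  unfold toPattern
  split_ifs <;> positivity

lemma SPP.lt_toPattern_iff (i m s : ℕ) (hi : 1 ≤ i) (him : i ≤ n - m) (hm : m ≤ n) (hs : s < c) :
    (s : ℤ) < P.toPattern n c i (n - m) ↔ i ≤ P.part m s := by
  rw [toPattern_of_le hi him (by omega), show n - (n - m) = m by omega, Nat.cast_lt]
  exact lt_card_filter_range_iff (p := fun s => i ≤ P.part m s)
    (fun _ _ h h' => h'.trans (P.row_decr m _ _ h)) hs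

lemma SPP.toPattern_le (i j : ℕ) : P.toPattern n c i j ≤ c := by
  unfold toPattern
  split_ifs
  · have := card_filter_le (range c) fun s => i ≤ P.part (n - j) s
    rw [card_range] at this
    exact_mod_cast this
  · exact le_rfl
  · positivity

lemma SPP.toPattern_interlace {i j : ℕ} (hi : 1 ≤ i) (hin : i + 1 ≤ n) (hij : i ≤ j)
    (hj : j ≤ n) : P.toPattern n c (i + 1) j ≤ P.toPattern n c i j ∧
      P.toPattern n c i j ≤ P.toPattern n c (i + 1) (j + 1) := by
  constructor
  · rcases hij.eq_or_lt with rfl | hij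
    · rw [toPattern_eq_zero (by omega)]
      exact toPattern_nonneg _ _
    · rw [toPattern_of_le (by omega) hij hj, toPattern_of_le hi hij.le hj]
      refine Nat.cast_le.2 (card_le_card (monotone_filter_right _ fun s _ hs => ?_))
      exact (Nat.le_succ i).trans hs
  · rcases hj.eq_or_lt with rfl | hj
    · rw [toPattern_last (by omega) hin]
      exact toPattern_le _ _
    · rw [toPattern_of_le (by omega) (by omega) hj, toPattern_of_le hi hij hj.le]
      refine Nat.cast_le.2 (card_le_card (monotone_filter_right _ fun s _ hs => ?_))
      have h := P.col_strict (n - (j + 1)) s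
      rw [show n - (j + 1) + 1 = n - j by omega] at h
      exact Nat.succ_le_of_lt (hs.trans_lt (h (by omega)))

lemma SPP.isPattern_toPattern (hn : 1 ≤ n) : IsPattern (n - 1) n c (P.toPattern n c) := by
  refine ⟨fun i hi hin => ⟨toPattern_eq_zero (by omega), toPattern_last hi (by omega)⟩,
    fun i j hi hin hij hj => ?_, fun i j h => toPattern_eq_zero (by omega)⟩
  have h := P.toPattern_interlace (n := n) (c := c) (i := i - 1) (j := j)
    (by omega) (by omega) (by omega) hj
  rw [show i - 1 + 1 = i by omega] at h
  exact ⟨fun _ => h, fun hlt => by omega⟩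

lemma SPP.toPattern_corner (hn : 1 ≤ n) (hP : ∀ i j, P.part i j ≤ n)
    (hc : ∀ i j, c ≤ j → P.part i j = 0) : P.toPattern n c n n = eqCount P n := by
  rw [toPattern_of_le hn le_rfl le_rfl, eqCount_eq hn hP, ← Set.ncard_coe_finset, Nat.sub_self]
  congr 2
  ext s
  simp only [coe_filter, mem_range, Set.mem_ofPred_eq, and_iff_right_iff_imp]
  intro h
  by_contra hs
  have := hc 0 s (by omega)
  omega

lemma SPP.patternPart_toPattern (hP : ∀ i j, P.part i j ≤ n)
    (hc : ∀ i j, c ≤ j → P.part i j = 0) (m s : ℕ) :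
    patternPart n (P.toPattern n c) m s = P.part m s := by
  have hle := P.part_le_sub hP m s
  have : {i ∈ Icc 1 (n - m) | (s : ℤ) < P.toPattern n c i (n - m)} = Icc 1 (P.part m s) := by
    ext i
    rw [mem_filter, mem_Icc, mem_Icc]
    rcases lt_or_ge s c with hs | hs
    · constructor
      · rintro ⟨⟨h1, h2⟩, h3⟩
        exact ⟨h1, (P.lt_toPattern_iff i m s h1 h2 (by omega) hs).1 h3⟩
      · rintro ⟨h1, h2⟩
        exact ⟨⟨h1, by omega⟩, (P.lt_toPattern_iff i m s h1 (by omega) (by omega) hs).2 h2⟩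
    · have h1 := hc m s hs
      have h2 := P.toPattern_le (n := n) (c := c) i (n - m)
      omega
  rw [patternPart, this, Nat.card_Icc, Nat.add_sub_cancel]

end OfSPP

lemma IsPattern.toPattern_toSPP {n c k : ℕ} {a : ℕ → ℕ → ℤ} (ha : IsPattern (n - 1) n c a)
    (hk : k ≤ c) (hak : a n n = k) (hn : 1 ≤ n) : (ha.toSPP hk hak).toPattern n c = a := by
  funext i j
  by_cases h : i = 0 ∨ n < i ∨ j + 1 < i ∨ n + 1 < j
  · rw [SPP.toPattern_eq_zero (by omega), ha.2.2 i j (by omega)]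
  have hends := ha.1 i (by omega) (by omega)
  rcases (show j = i - 1 ∨ j = n + 1 ∨ (i ≤ j ∧ j ≤ n) by omega) with rfl | rfl | ⟨hij, hj⟩
  · rw [SPP.toPattern_eq_zero (by omega), hends.1]
  · rw [SPP.toPattern_last (by omega) (by omega), hends.2]
  · rw [SPP.toPattern_of_le (by omega) hij hj,
      ← ha.card_filter_range hk hak (by omega) hij hj]
    congr 2
    refine filter_congr fun s _ => ?_
    have := ha.le_patternPart_iff hk hak (i := i) (m := n - j) (s := s) (by omega) (by omega)
    rwa [show n - (n - j) = j by omega] at this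

/-- **Lemma 1 (the fundamental bijection).** Gelfand-Tsetlin patterns with `n` rows, parts
in `{0,…,c}` and `a n n = k` are in norm-preserving bijection with strict plane partitions
with parts in `{1,…,n}`, at most `c` columns and `k` parts equal to `n`; moreover
`(a_{1,n}, a_{1,n-1}, …, a_{1,1})` is the shape of the corresponding plane partition. -/
theorem statement3 (n c k : ℕ) (hn : 1 ≤ n) (hk : k ≤ c) :
    ∃ e : {a : ℕ → ℕ → ℤ | IsPattern (n - 1) n c a ∧ 0 ≤ a n n ∧ a n n ≤ c ∧ a n n = k} ≃
          {P : SPP | (∀ i j, P.part i j ≤ n) ∧ (∀ i j, c ≤ j → P.part i j = 0) ∧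
            eqCount P n = k},
      ∀ x, ((sppNorm (e x).1 : ℤ) = patNorm (n - 1) n x.1 ∧
        (∀ i, i < n → (rowLen (e x).1 i : ℤ) = x.1 1 (n - i)) ∧
        (∀ i, n ≤ i → rowLen (e x).1 i = 0)) := by
  refine ⟨{
    toFun := fun x => ⟨x.2.1.toSPP hk x.2.2.2.2,
      fun m s => (patternPart_le m s).trans (Nat.sub_le n m),
      fun _ _ hs => x.2.1.patternPart_eq_zero hk x.2.2.2.2 hs,
      x.2.1.eqCount_toSPP hk x.2.2.2.2 hn⟩
    invFun := fun P => ⟨P.1.toPattern n c, SPP.isPattern_toPattern hn,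
      SPP.toPattern_nonneg n n, SPP.toPattern_le n n, by
        rw [SPP.toPattern_corner hn P.2.1 P.2.2.1, P.2.2.2]⟩
    left_inv := fun x => Subtype.ext (x.2.1.toPattern_toSPP hk x.2.2.2.2 hn)
    right_inv := fun P => Subtype.ext
      (SPP.eq_of_part_eq (SPP.patternPart_toPattern P.2.1 P.2.2.1)) }, fun x => ?_⟩
  exact ⟨x.2.1.sppNorm_toSPP hk x.2.2.2.2 hn,
    fun _ => x.2.1.rowLen_toSPP hk x.2.2.2.2,
    fun _ => x.2.1.rowLen_toSPP_eq_zero hk x.2.2.2.2⟩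
end

section
/- Let t ≥ 1 and d ≥ 0 be integers and let ρ ∈ ℂ be a primitive t-th root of unity. Suppose c_{i,j} ∈ ℂ(q) are given for 0 ≤ i ≤ t−1 and 0 ≤ j ≤ d, and define p : ℤ → ℂ(q) by p(x) = Σ_{i=0}^{t−1} Σ_{j=0}^{d} c_{i,j} ρ^{i x} [x;q]_j. Then there exist elements d_{i,j} ∈ ℂ(q) for 0 ≤ i ≤ t−1 and 0 ≤ j ≤ d+1 such that for every integer y ≥ 0, Σ_{x=0}^{y} p(x) q^x = Σ_{i=0}^{t−1} Σ_{j=0}^{d+1} d_{i,j} ρ^{i y} [y;q]_j. (A sum of a q-quasi-polynomial of degree d and period t against q^x is again a q-quasi-polynomial, of degree at most d+1 and period at most t.) -/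
open Finset

noncomputable def qC : RatFunc ℂ := RatFunc.X

noncomputable def qbC (a : ℤ) : RatFunc ℂ := (1 - qC ^ a) / (1 - qC)

noncomputable def qfacC (a : ℤ) (n : ℕ) : RatFunc ℂ := ∏ i ∈ Finset.range n, qbC (a + i)

theorem C_mul_qC_pow_ne_one (a : ℂ) {k : ℕ} (hk : k ≠ 0) : RatFunc.C a * qC ^ k ≠ 1 := by
  intro h
  have h' : algebraMap (Polynomial ℂ) (RatFunc ℂ) (Polynomial.C a * Polynomial.X ^ k) =
      algebraMap (Polynomial ℂ) (RatFunc ℂ) 1 := by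
    simpa [qC, RatFunc.algebraMap_C, RatFunc.algebraMap_X] using h
  have h0 := congrArg (Polynomial.eval 0) (RatFunc.algebraMap_injective ℂ h')
  simp [hk] at h0

theorem qC_ne_zero : qC ≠ 0 := RatFunc.X_ne_zero

theorem one_sub_qC_ne_zero : 1 - qC ≠ 0 := by
  have h := C_mul_qC_pow_ne_one 1 one_ne_zero
  rw [map_one, one_mul, pow_one] at h
  exact sub_ne_zero.mpr h.symm

theorem qfacC_succ (y j : ℕ) :
    qfacC y (j + 1) = qfacC y j * ((1 - qC ^ y * qC ^ j) / (1 - qC)) := by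
  rw [qfacC, Finset.prod_range_succ, ← qfacC, qbC, ← Nat.cast_add, zpow_natCast, pow_add]

theorem qfacC_mul_qC_pow (y j : ℕ) :
    qfacC y j * qC ^ y = (qC ^ j)⁻¹ * (qfacC y j - (1 - qC) * qfacC y (j + 1)) := by
  have h₁ := one_sub_qC_ne_zero
  have h₂ := pow_ne_zero j qC_ne_zero
  rw [qfacC_succ]
  field_simp
  ring

/-- Every rising `q`-factorial `[y;q]_j` is a polynomial of degree at most `j` in `q ^ y`. -/
theorem exists_polynomial_qfacC (j : ℕ) :
    ∃ P : Polynomial (RatFunc ℂ), P.natDegree ≤ j ∧ ∀ y : ℕ, qfacC y j = P.eval (qC ^ y) := by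
  induction j with
  | zero => exact ⟨1, by simp, fun y => by simp [qfacC]⟩
  | succ j ih =>
    obtain ⟨P, hP, h⟩ := ih
    refine ⟨P * (Polynomial.C (-qC ^ j / (1 - qC)) * Polynomial.X +
      Polynomial.C (1 / (1 - qC))),
      Polynomial.natDegree_mul_le.trans (add_le_add hP Polynomial.natDegree_linear_le),
      fun y => ?_⟩
    rw [qfacC_succ, h]
    simp only [Polynomial.eval_mul, Polynomial.eval_add, Polynomial.eval_C, Polynomial.eval_X]
    ring

/-- The functions `y ↦ ∑ i < t, ∑ j ≤ n, e i j * r ^ (i * y) * [y;q]_j` on the naturals. -/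
noncomputable def qQuasiPolynomial (r : RatFunc ℂ) (t n : ℕ) :
    Submodule (RatFunc ℂ) (ℕ → RatFunc ℂ) where
  carrier := {f | ∃ e : ℕ → ℕ → RatFunc ℂ, ∀ y : ℕ, f y =
    ∑ i ∈ Finset.range t, ∑ j ∈ Finset.range (n + 1), e i j * r ^ ((i : ℤ) * y) * qfacC y j}
  zero_mem' := ⟨0, fun y => by simp⟩
  add_mem' := by
    rintro f g ⟨a, ha⟩ ⟨b, hb⟩
    exact ⟨a + b, fun y => by simp [ha, hb, add_mul, Finset.sum_add_distrib]⟩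
  smul_mem' := by
    rintro s f ⟨a, ha⟩
    exact ⟨s • a, fun y => by simp [ha, Finset.mul_sum, mul_assoc]⟩

section

variable {r : RatFunc ℂ} {t n i : ℕ}

theorem mem_qQuasiPolynomial {f : ℕ → RatFunc ℂ} :
    f ∈ qQuasiPolynomial r t n ↔ ∃ e : ℕ → ℕ → RatFunc ℂ, ∀ y : ℕ, f y =
      ∑ i ∈ Finset.range t, ∑ j ∈ Finset.range (n + 1),
        e i j * r ^ ((i : ℤ) * y) * qfacC y j :=
  Iff.rfl

theorem pow_mul_qfacC_mem_qQuasiPolynomial (hi : i < t) {j : ℕ} (hj : j ≤ n) :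
    (fun y : ℕ => r ^ (i * y) * qfacC y j) ∈ qQuasiPolynomial r t n := by
  refine ⟨fun a b => if a = i then if b = j then 1 else 0 else 0, fun y => ?_⟩
  rw [Finset.sum_eq_single_of_mem i (Finset.mem_range.mpr hi) (by simp +contextual),
    Finset.sum_eq_single_of_mem j (Finset.mem_range.mpr (by omega)) (by simp +contextual)]
  simp only [if_true, one_mul, ← Nat.cast_mul, zpow_natCast]

theorem mul_qC_pow_mem_qQuasiPolynomial {f : ℕ → RatFunc ℂ} (hf : f ∈ qQuasiPolynomial r t n) :
    (fun y => f y * qC ^ y) ∈ qQuasiPolynomial r t (n + 1) := by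
  obtain ⟨e, he⟩ := hf
  have : (fun y => f y * qC ^ y) = ∑ i ∈ Finset.range t, ∑ j ∈ Finset.range (n + 1),
      (e i j * (qC ^ j)⁻¹) • ((fun y : ℕ => r ^ (i * y) * qfacC y j) -
        (1 - qC) • fun y : ℕ => r ^ (i * y) * qfacC y (j + 1)) := by
    funext y
    simp only [he, Finset.sum_apply, Finset.sum_mul, Pi.smul_apply, Pi.sub_apply, smul_eq_mul]
    refine Finset.sum_congr rfl fun i _ => Finset.sum_congr rfl fun j _ => ?_
    rw [mul_assoc, qfacC_mul_qC_pow, ← Nat.cast_mul, zpow_natCast]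
    ring
  rw [this]
  refine Submodule.sum_mem _ fun i hi => Submodule.sum_mem _ fun j hj => ?_
  rw [Finset.mem_range] at hi hj
  exact Submodule.smul_mem _ _ (Submodule.sub_mem _
    (pow_mul_qfacC_mem_qQuasiPolynomial hi (by omega))
    (Submodule.smul_mem _ _ (pow_mul_qfacC_mem_qQuasiPolynomial hi (by omega))))

theorem qQuasiPolynomial_mono : Monotone (qQuasiPolynomial r t) := by
  rintro m n hmn f ⟨e, he⟩
  have : f = ∑ i ∈ Finset.range t, ∑ j ∈ Finset.range (m + 1),
      e i j • fun y : ℕ => r ^ (i * y) * qfacC y j := by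
    funext y
    simp only [he, Finset.sum_apply, Pi.smul_apply, smul_eq_mul, mul_assoc, ← Nat.cast_mul,
      zpow_natCast]
  rw [this]
  refine Submodule.sum_mem _ fun i hi => Submodule.sum_mem _ fun j hj => ?_
  rw [Finset.mem_range] at hi hj
  exact Submodule.smul_mem _ _ (pow_mul_qfacC_mem_qQuasiPolynomial hi (by omega))

theorem geom_mem_qQuasiPolynomial (hi : i < t) {k : ℕ} (hk : k ≤ n) :
    (fun y : ℕ => (r ^ i * qC ^ k) ^ y) ∈ qQuasiPolynomial r t n := by
  refine qQuasiPolynomial_mono hk ?_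
  clear hk
  induction k with
  | zero =>
    convert pow_mul_qfacC_mem_qQuasiPolynomial (r := r) hi (le_refl 0) using 2 with y
    simp [qfacC, pow_mul]
  | succ k ih =>
    convert mul_qC_pow_mem_qQuasiPolynomial ih using 2 with y
    rw [← mul_pow, mul_assoc, pow_succ]

theorem sum_geom_mem_qQuasiPolynomial (hi : i < t) {k : ℕ} (hk : k ≤ n)
    (h : r ^ i * qC ^ k ≠ 1) :
    (fun y : ℕ => ∑ x ∈ Finset.range (y + 1), (r ^ i * qC ^ k) ^ x) ∈
      qQuasiPolynomial r t n := by
  have : (fun y : ℕ => ∑ x ∈ Finset.range (y + 1), (r ^ i * qC ^ k) ^ x) =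
      (r ^ i * qC ^ k - 1)⁻¹ • ((r ^ i * qC ^ k) • (fun y : ℕ => (r ^ i * qC ^ k) ^ y) -
        fun y : ℕ => (r ^ 0 * qC ^ 0) ^ y) := by
    funext y
    simp only [Pi.smul_apply, Pi.sub_apply, smul_eq_mul]
    rw [geom_sum_eq h, pow_succ', div_eq_inv_mul]
    simp
  rw [this]
  exact Submodule.smul_mem _ _ (Submodule.sub_mem _
    (Submodule.smul_mem _ _ (geom_mem_qQuasiPolynomial hi hk))
    (geom_mem_qQuasiPolynomial (by omega) (Nat.zero_le n)))

end

/-- **Lemma 2.** Summing a `q`-quasi-polynomial of degree `d` and period `t` against `q^x`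
yields a `q`-quasi-polynomial of degree at most `d+1` and period at most `t`. -/
theorem statement4 (t d : ℕ) (ht : 1 ≤ t) (ρ : ℂ) (hρ : IsPrimitiveRoot ρ t)
    (c : ℕ → ℕ → RatFunc ℂ) (p : ℤ → RatFunc ℂ)
    (hp : ∀ x : ℤ, p x = ∑ i ∈ Finset.range t, ∑ j ∈ Finset.range (d + 1),
      c i j * RatFunc.C ρ ^ ((i : ℤ) * x) * qfacC x j) :
    ∃ e : ℕ → ℕ → RatFunc ℂ, ∀ y : ℕ,
      ∑ x ∈ Finset.range (y + 1), p x * qC ^ x =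
        ∑ i ∈ Finset.range t, ∑ j ∈ Finset.range (d + 2),
          e i j * RatFunc.C ρ ^ ((i : ℤ) * y) * qfacC y j := by
  suffices h : (fun y : ℕ => ∑ x ∈ Finset.range (y + 1), p x * qC ^ x) ∈
      qQuasiPolynomial (RatFunc.C ρ) t (d + 1) from mem_qQuasiPolynomial.mp h
  choose P hPdeg hP using exists_polynomial_qfacC
  have hsum : (fun y : ℕ => ∑ x ∈ Finset.range (y + 1), p x * qC ^ x) =
      ∑ i ∈ Finset.range t, ∑ j ∈ Finset.range (d + 1), ∑ k ∈ Finset.range (j + 1),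
        (c i j * (P j).coeff k) • fun y : ℕ =>
          ∑ x ∈ Finset.range (y + 1), (RatFunc.C ρ ^ i * qC ^ (k + 1)) ^ x := by
    funext y
    simp only [Finset.sum_apply, Pi.smul_apply, smul_eq_mul, Finset.mul_sum, hp, Finset.sum_mul]
    rw [Finset.sum_comm]
    refine Finset.sum_congr rfl fun i _ => ?_
    rw [Finset.sum_comm]
    refine Finset.sum_congr rfl fun j _ => ?_
    rw [Finset.sum_comm]
    refine Finset.sum_congr rfl fun x _ => ?_
    rw [hP, Polynomial.eval_eq_sum_range' (Nat.lt_succ_of_le (hPdeg j)), Finset.mul_sum,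
      Finset.sum_mul, ← Nat.cast_mul, zpow_natCast]
    refine Finset.sum_congr rfl fun k _ => ?_
    ring
  rw [hsum]
  refine Submodule.sum_mem _ fun i hi => Submodule.sum_mem _ fun j hj =>
    Submodule.sum_mem _ fun k hk => Submodule.smul_mem _ _ ?_
  rw [Finset.mem_range] at hi hj hk
  refine sum_geom_mem_qQuasiPolynomial hi (by omega) ?_
  rw [← map_pow]
  exact C_mul_qC_pow_ne_one _ k.succ_ne_zero
end

section
/- Let n ≥ 0 and y ≥ 0 be integers. In the field ℚ(q)(σ) of rational functions in two indeterminates q and σ, the following identity holds: Σ_{x=0}^{y} [x;q]_n q^x σ^{x−1} = D_{qσ}^n ( σ^{n−1}((σq)^{y+1} − 1)/(σq − 1) ), where D_{qσ}^n denotes the n-fold application of the q-differential operator D_{qσ}. -/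
open Finset

/-- The element `q` of `ℚ(q)(σ)` (the coefficient-field variable). -/
noncomputable def QQ : RatFunc (RatFunc ℚ) := RatFunc.C RatFunc.X

/-- The element `σ` of `ℚ(q)(σ)`. -/
noncomputable def SS : RatFunc (RatFunc ℚ) := RatFunc.X

noncomputable def qbS (a : ℤ) : RatFunc (RatFunc ℚ) := (1 - QQ ^ a) / (1 - QQ)

noncomputable def qfacS (a : ℤ) (n : ℕ) : RatFunc (RatFunc ℚ) :=
  ∏ i ∈ Finset.range n, qbS (a + i)

/-- Substitution `σ ↦ q·σ` on `ℚ(q)(σ)`, computed on numerator and denominator. -/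
noncomputable def subq (f : RatFunc (RatFunc ℚ)) : RatFunc (RatFunc ℚ) :=
  Polynomial.eval₂ RatFunc.C (QQ * RatFunc.X) f.num /
    Polynomial.eval₂ RatFunc.C (QQ * RatFunc.X) f.denom

/-- The `q`-differential operator `f(σ) ↦ (f(qσ) - f(σ))/(σ(q-1))`. -/
noncomputable def Dq (f : RatFunc (RatFunc ℚ)) : RatFunc (RatFunc ℚ) :=
  (subq f - f) / (SS * (QQ - 1))

theorem SS_ne_zero : SS ≠ 0 := RatFunc.X_ne_zero

theorem QQ_sub_one_ne_zero : QQ - 1 ≠ 0 := by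
  intro h
  have h1 : (RatFunc.X : RatFunc ℚ) = 1 := by
    apply (RatFunc.C (K := RatFunc ℚ)).injective
    rw [map_one]
    exact sub_eq_zero.mp h
  have h2 : (Polynomial.X : Polynomial ℚ) = 1 := by
    apply RatFunc.algebraMap_injective ℚ
    simpa using h1
  simpa using congrArg (Polynomial.coeff · 0) h2

theorem SS_mul_QQ_sub_one_ne_zero : SS * QQ - 1 ≠ 0 := by
  intro h
  have h1 : (Polynomial.X * Polynomial.C RatFunc.X : Polynomial (RatFunc ℚ)) = 1 := by
    apply RatFunc.algebraMap_injective (RatFunc ℚ)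
    rw [map_mul, map_one, RatFunc.algebraMap_X, RatFunc.algebraMap_C]
    exact sub_eq_zero.mp h
  simpa using congrArg (Polynomial.coeff · 0) h1

theorem eval₂_QQ_mul_X_ne_zero {p : Polynomial (RatFunc ℚ)} (hp : p ≠ 0) :
    p.eval₂ RatFunc.C (QQ * RatFunc.X) ≠ 0 := by
  have h : p.eval₂ RatFunc.C (QQ * RatFunc.X) = algebraMap (Polynomial (RatFunc ℚ))
      (RatFunc (RatFunc ℚ)) (p.comp (Polynomial.C RatFunc.X * Polynomial.X)) := by
    rw [Polynomial.comp, Polynomial.hom_eval₂]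
    congr 1
    simp [QQ]
  rw [h]
  refine RatFunc.algebraMap_ne_zero ?_
  rwa [Ne, Polynomial.comp_C_mul_X_eq_zero_iff]
  exact mem_nonZeroDivisors_of_ne_zero RatFunc.X_ne_zero

theorem eval₂_denom_ne_zero (f : RatFunc (RatFunc ℚ)) :
    f.denom.eval₂ RatFunc.C (QQ * RatFunc.X) ≠ 0 :=
  eval₂_QQ_mul_X_ne_zero f.denom_ne_zero

/-- The substitution `σ ↦ q·σ` as a ring homomorphism. -/
noncomputable def subqHom : RatFunc (RatFunc ℚ) →+* RatFunc (RatFunc ℚ) where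
  toFun := subq
  map_one' := RatFunc.eval_one _ _
  map_mul' f g := RatFunc.eval_mul _ _ (eval₂_denom_ne_zero f) (eval₂_denom_ne_zero g)
  map_zero' := RatFunc.eval_zero _ _
  map_add' f g := RatFunc.eval_add _ _ (eval₂_denom_ne_zero f) (eval₂_denom_ne_zero g)

theorem subqHom_apply (f : RatFunc (RatFunc ℚ)) : subqHom f = subq f := rfl

theorem subqHom_C (c : RatFunc ℚ) : subqHom (RatFunc.C c) = RatFunc.C c :=
  RatFunc.eval_C _ _

theorem subqHom_SS : subqHom SS = QQ * SS :=
  RatFunc.eval_X _ _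

/-- The operator `Dq` as an additive homomorphism. -/
noncomputable def DqHom : RatFunc (RatFunc ℚ) →+ RatFunc (RatFunc ℚ) where
  toFun := Dq
  map_zero' := by simp [Dq, ← subqHom_apply]
  map_add' f g := by
    simp only [Dq, ← subqHom_apply, map_add]
    ring

theorem Dq_iterate_sum {ι : Type*} (s : Finset ι) (f : ι → RatFunc (RatFunc ℚ)) (n : ℕ) :
    Dq^[n] (∑ x ∈ s, f x) = ∑ x ∈ s, Dq^[n] (f x) := by
  induction n generalizing f with
  | zero => rfl
  | succ n ih =>
    simp only [Function.iterate_succ_apply]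
    rw [← ih]
    congr 1
    exact map_sum DqHom f s

theorem qbS_eq_C (a : ℤ) :
    qbS a = RatFunc.C ((1 - RatFunc.X ^ a) / (1 - RatFunc.X)) := by
  simp [qbS, QQ]

theorem Dq_C_mul_zpow (c : RatFunc ℚ) (a : ℤ) :
    Dq (RatFunc.C c * SS ^ (a + 1)) = qbS (a + 1) * RatFunc.C c * SS ^ a := by
  have h1 := QQ_sub_one_ne_zero
  have h2 : 1 - QQ ≠ 0 := by rwa [← neg_sub, neg_ne_zero]
  have h3 := SS_ne_zero
  rw [Dq, ← subqHom_apply, map_mul, map_zpow₀, subqHom_C, subqHom_SS, mul_zpow, qbS,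
    zpow_add_one₀ h3, div_mul_eq_mul_div, div_mul_eq_mul_div,
    div_eq_div_iff (mul_ne_zero h3 h1) h2]
  ring

theorem Dq_iterate_C_mul_zpow (n : ℕ) (c : RatFunc ℚ) (a : ℤ) :
    Dq^[n] (RatFunc.C c * SS ^ (a + n)) = qfacS (a + 1) n * RatFunc.C c * SS ^ a := by
  induction n generalizing c with
  | zero => simp [qfacS]
  | succ n ih =>
    rw [Function.iterate_succ_apply, Nat.cast_succ, ← add_assoc, Dq_C_mul_zpow, qbS_eq_C,
      ← map_mul, ih, map_mul, ← qbS_eq_C, qfacS, qfacS, Finset.prod_range_succ,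
      add_right_comm a n 1]
    ring

/-- **Lemma 4.** `Σ_{x=0}^y [x;q]_n q^x σ^{x-1}
  = (d/d_q σ)^n ( σ^{n-1}((σq)^{y+1} - 1)/(σq - 1) )`. -/
theorem statement5 (n y : ℕ) :
    ∑ x ∈ Finset.range (y + 1), qfacS x n * QQ ^ x * SS ^ ((x : ℤ) - 1) =
      Dq^[n] (SS ^ ((n : ℤ) - 1) * ((SS * QQ) ^ (y + 1) - 1) / (SS * QQ - 1)) := by
  have h : SS ^ ((n : ℤ) - 1) * ((SS * QQ) ^ (y + 1) - 1) / (SS * QQ - 1) =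
      ∑ x ∈ Finset.range (y + 1),
        RatFunc.C ((RatFunc.X : RatFunc ℚ) ^ x) * SS ^ ((x : ℤ) - 1 + n) := by
    rw [mul_div_assoc, ← geom_sum_eq (sub_ne_zero.mp SS_mul_QQ_sub_one_ne_zero),
      Finset.mul_sum]
    refine Finset.sum_congr rfl fun x _ => ?_
    rw [map_pow, show (x : ℤ) - 1 + n = (n - 1) + x by ring, zpow_add₀ SS_ne_zero,
      zpow_natCast, mul_pow, QQ]
    ring
  rw [h, Dq_iterate_sum]
  refine Finset.sum_congr rfl fun x _ => ?_
  rw [Dq_iterate_C_mul_zpow, sub_add_cancel, map_pow, QQ]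
end

section
/- Let n ≥ 0 and 0 ≤ p ≤ n be integers and let (k_1,…,k_n) ∈ ℤ^n. For 0 ≤ i ≤ n let T(n,i) = Σ_{1≤j_1<j_2<…<j_i≤n} (−1)^{k_{j_1}+k_{j_2}+⋯+k_{j_i}} (so T(n,0) = 1). Then, as rational numbers, S(n,p) = (1/2^n) Σ_{i=0}^{n} ( Σ_{l=max(0,i−n+p)}^{min(p,i)} (−1)^l · C(i,l) · C(n−i,p−l) ) · T(n,i), where S(n,p) equals 1 if exactly p of k_1,…,k_n are odd and equals 0 otherwise, and C(a,b) denotes the ordinary binomial coefficient. -/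
open Polynomial in
theorem coeff_one_sub_X_pow_mul_one_add_X_pow {R : Type*} [CommRing R] {n p i : ℕ}
    (hi : i ≤ n) :
    (((1 - X) ^ i * (1 + X) ^ (n - i) : R[X])).coeff p =
      ∑ l ∈ Finset.Icc (i + p - n) (min p i),
        (-1 : R) ^ l * (Nat.choose i l) * (Nat.choose (n - i) (p - l)) := by
  have coeff_one_sub (l : ℕ) : ((1 - X : R[X]) ^ i).coeff l = (-1) ^ l * (Nat.choose i l) := by
    have h : (1 - X : R[X]) ^ i = ((1 + X) ^ i).comp (C (-1) * X) := by simp [sub_eq_add_neg]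
    rw [h, comp_C_mul_X_coeff, coeff_one_add_X_pow, mul_comm]
  rw [coeff_mul, Finset.Nat.sum_antidiagonal_eq_sum_range_succ
    (fun a b => ((1 - X : R[X]) ^ i).coeff a * ((1 + X : R[X]) ^ (n - i)).coeff b)]
  simp only [coeff_one_sub, coeff_one_add_X_pow]
  symm
  apply Finset.sum_subset
  · intro l
    simp only [Finset.mem_Icc, Finset.mem_range]
    omega
  · intro l h₁ h₂
    simp only [Finset.mem_Icc, Finset.mem_range] at h₁ h₂
    by_cases hl : i < l
    · simp [Nat.choose_eq_zero_of_lt hl]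
    · rw [Nat.choose_eq_zero_of_lt (show n - i < p - l by omega)]
      simp

theorem zpow_sum_eq_prod_zpow {ι G : Type*} [CommGroupWithZero G] {a : G} (ha : a ≠ 0)
    (s : Finset ι) (k : ι → ℤ) : a ^ (∑ j ∈ s, k j) = ∏ j ∈ s, a ^ k j := by
  classical
  induction s using Finset.induction_on with
  | empty => simp
  | insert j s hj ih => rw [Finset.sum_insert hj, Finset.prod_insert hj, zpow_add₀ ha, ih]

open Polynomial in
theorem prod_neg_one_zpow_mul_one_sub_X_add_one_add_X {ι : Type*} (s : Finset ι) (k : ι → ℤ) :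
    ∏ j ∈ s, (C ((-1 : ℚ) ^ k j) * (1 - X) + (1 + X)) =
      C (2 ^ s.card) * X ^ (s.filter fun j => Odd (k j)).card := by
  have factor (j : ι) : C ((-1 : ℚ) ^ k j) * (1 - X) + (1 + X) =
      C 2 * (if Odd (k j) then X else 1) := by
    have two : (C 2 : ℚ[X]) = 2 := rfl
    split_ifs with h
    · rw [h.neg_one_zpow, two, C_neg, C_1]; ring
    · rw [(Int.not_odd_iff_even.mp h).neg_one_zpow, two, C_1]; ring
  simp only [factor, Finset.prod_mul_distrib, Finset.prod_const, Finset.prod_ite, one_pow,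
    mul_one, C_pow]

open Polynomial in
theorem prod_C_mul_one_sub_X_add_one_add_X {ι R : Type*} [CommRing R] (s : Finset ι)
    (ε : ι → R) :
    ∏ j ∈ s, (C (ε j) * (1 - X) + (1 + X)) =
      ∑ i ∈ Finset.range (s.card + 1), ∑ t ∈ Finset.powersetCard i s,
        C (∏ j ∈ t, ε j) * ((1 - X) ^ i * (1 + X) ^ (s.card - i)) := by
  classical
  rw [Finset.prod_add, Finset.sum_powerset]
  refine Finset.sum_congr rfl fun i _ => Finset.sum_congr rfl fun t ht => ?_
  obtain ⟨hts, rfl⟩ := Finset.mem_powersetCard.mp ht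
  rw [Finset.prod_mul_distrib, Finset.prod_const, Finset.prod_const,
    Finset.card_sdiff_of_subset hts, map_prod, mul_assoc]

open Finset

/-- **Lemma 5.** The indicator `S(n,p)` of "exactly `p` of `k_1,…,k_n` are odd" as a
linear combination of the functions `T(n,i)`. -/
theorem statement6 (n p : ℕ) (hp : p ≤ n) (k : ℕ → ℤ) :
    (if {j | 1 ≤ j ∧ j ≤ n ∧ Odd (k j)}.ncard = p then (1 : ℚ) else 0) =
      (1 / 2 ^ n) *
        ∑ i ∈ Finset.range (n + 1),
          (∑ l ∈ Finset.Icc (i + p - n) (min p i),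
            (-1 : ℚ) ^ l * (Nat.choose i l) * (Nat.choose (n - i) (p - l))) *
          ∑ s ∈ Finset.powersetCard i (Finset.Icc 1 n),
            (-1 : ℚ) ^ (∑ j ∈ s, k j) := by
  have hcard : {j | 1 ≤ j ∧ j ≤ n ∧ Odd (k j)}.ncard =
      ((Finset.Icc 1 n).filter fun j => Odd (k j)).card := by
    rw [← Set.ncard_coe_finset]
    congr 1
    ext j
    simp [and_assoc]
  have hcoeff := congrArg (fun q => Polynomial.coeff q p)
    ((prod_C_mul_one_sub_X_add_one_add_X (Finset.Icc 1 n) fun j => (-1 : ℚ) ^ k j).symm.trans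
      (prod_neg_one_zpow_mul_one_sub_X_add_one_add_X (Finset.Icc 1 n) k))
  simp only [Polynomial.finsetSum_coeff, Polynomial.coeff_C_mul, Nat.card_Icc,
    Nat.add_sub_cancel, Polynomial.coeff_X_pow] at hcoeff
  have hsum : ∑ i ∈ Finset.range (n + 1),
      (∑ l ∈ Finset.Icc (i + p - n) (min p i),
        (-1 : ℚ) ^ l * (Nat.choose i l) * (Nat.choose (n - i) (p - l))) *
      ∑ s ∈ Finset.powersetCard i (Finset.Icc 1 n), (-1 : ℚ) ^ (∑ j ∈ s, k j) =
      2 ^ n * if p = ((Finset.Icc 1 n).filter fun j => Odd (k j)).card then 1 else 0 := by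
    rw [← hcoeff]
    refine Finset.sum_congr rfl fun i hi => ?_
    rw [← coeff_one_sub_X_pow_mul_one_add_X_pow (Finset.mem_range_succ_iff.mp hi),
      Finset.mul_sum]
    refine Finset.sum_congr rfl fun s _ => ?_
    rw [zpow_sum_eq_prod_zpow (by norm_num), mul_comm]
  rw [hsum, hcard, ← mul_assoc, one_div_mul_cancel (by positivity), one_mul]
  simp only [eq_comm]
end
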